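/- arXiv:2503.13256 — 11 statements merged into one kernel-verified Lean document; each statement's English description precedes it below -/
import Mathlib

section
/- Let 1 < α < 2, let G : ℝ → ℝ be continuous, and define the fractional map of order α (with h = 1, initial data x_0, p_0 ∈ ℝ) by x_{n+1} = x_0 + p_0·(n+1) − (1/Γ(α)) Σ_{k=0}^{n} G(x_k)·(n−k+1)^{α−1} and p_{n+1} = p_0 − (1/Γ(α−1)) Σ_{k=0}^{n} G(x_k)·(n−k+1)^{α−2}. Let l > 1 be an integer and suppose that for every j ∈ {1, …, l} the limits x_{lim,j} = lim_{N→∞} x_{Nl+j} and p_{lim,j} = lim_{N→∞} p_{Nl+j} exist. Then the total of all limiting momenta is zero: Σ_{j=1}^{l} p_{lim,j} = 0. -/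
open Filter Finset

/-- If a real sequence converges along every residue class modulo `l`, then it is bounded. -/
theorem exists_abs_le_of_tendsto_residues {u a : ℕ → ℝ} {l : ℕ} (hl : 0 < l)
    (h : ∀ j ∈ range l, Tendsto (fun N : ℕ => u (N * l + j)) atTop (nhds (a j))) :
    ∃ B, ∀ i, |u i| ≤ B := by
  have hbd : ∀ j, ∃ C : ℝ, 0 ≤ C ∧ (j ∈ range l → ∀ N, |u (N * l + j)| ≤ C) := by
    intro j
    by_cases hj : j ∈ range l
    · obtain ⟨C, hC⟩ := (Metric.isBounded_range_of_tendsto _ (h j hj)).exists_norm_le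
      have hC' : ∀ N, |u (N * l + j)| ≤ C := fun N => hC _ ⟨N, rfl⟩
      exact ⟨C, (abs_nonneg _).trans (hC' 0), fun _ => hC'⟩
    · exact ⟨0, le_rfl, fun hj' => absurd hj' hj⟩
  choose C hC0 hC using hbd
  refine ⟨∑ j ∈ range l, C j, fun i => ?_⟩
  have hi : i % l ∈ range l := mem_range.2 (Nat.mod_lt _ hl)
  have h1 := hC (i % l) hi (i / l)
  rw [mul_comm, Nat.div_add_mod] at h1
  exact h1.trans (single_le_sum (fun j _ => hC0 j) hi)

theorem sum_range_mul_eq_sum_blocks (u : ℕ → ℝ) (l N : ℕ) :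
    ∑ i ∈ range (N * l), u i = ∑ q ∈ range N, ∑ j ∈ range l, u (q * l + j) := by
  induction N with
  | zero => simp
  | succ N ih => rw [add_mul, one_mul, sum_range_add, ih, sum_range_succ]

theorem abs_sum_range_le {u : ℕ → ℝ} {B : ℝ} (hB : ∀ i, |u i| ≤ B) (n : ℕ) :
    |∑ i ∈ range n, u i| ≤ n * B := by
  refine (abs_sum_le_sum_abs _ _).trans ?_
  simpa using sum_le_card_nsmul (range n) (fun i => |u i|) B (fun i _ => hB i)

/-- The Cesàro means of a sequence converging along every residue class modulo `l` converge to
the mean of the limits. -/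
theorem tendsto_cesaro_of_tendsto_residues {u a : ℕ → ℝ} {l : ℕ} (hl : 0 < l)
    (h : ∀ j ∈ range l, Tendsto (fun N : ℕ => u (N * l + j)) atTop (nhds (a j))) :
    Tendsto (fun n : ℕ => (∑ i ∈ range n, u i) / n) atTop
      (nhds ((∑ j ∈ range l, a j) / l)) := by
  obtain ⟨B, hB⟩ := exists_abs_le_of_tendsto_residues hl h
  have hB0 : 0 ≤ B := (abs_nonneg _).trans (hB 0)
  have hl' : (0 : ℝ) < l := by exact_mod_cast hl
  set P := ∑ j ∈ range l, a j
  have hblock : Tendsto (fun q : ℕ => ∑ j ∈ range l, u (q * l + j) - P) atTop (nhds 0) := by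
    have := (tendsto_finsetSum (range l) h).sub_const P
    simpa [P] using this
  have hces := (hblock.cesaro).comp (Nat.tendsto_div_const_atTop hl.ne')
  rw [tendsto_iff_norm_sub_tendsto_zero]
  have hlim : Tendsto (fun n : ℕ => |((n / l : ℕ) : ℝ)⁻¹ *
      ∑ q ∈ range (n / l), (∑ j ∈ range l, u (q * l + j) - P)| + (l * B + |P|) * (n : ℝ)⁻¹)
      atTop (nhds 0) := by
    have h1 := hces.abs
    have h2 := (tendsto_inv_atTop_nhds_zero_nat (𝕜 := ℝ)).const_mul (l * B + |P|)
    simpa [Function.comp_def] using h1.add h2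
  refine tendsto_of_tendsto_of_tendsto_of_le_of_le' tendsto_const_nhds hlim
    (Eventually.of_forall fun n => norm_nonneg _) ?_
  filter_upwards [eventually_ge_atTop l] with n hn
  have hn0 : (0 : ℝ) < n := by exact_mod_cast hl.trans_le hn
  have hq0 : (0 : ℝ) < (n / l : ℕ) := by exact_mod_cast Nat.div_pos hn hl
  set q := n / l with hq
  have hnq : q * l + n % l = n := by rw [mul_comm]; exact Nat.div_add_mod n l
  set r := n % l with hr
  have hrl : (r : ℝ) ≤ l := by exact_mod_cast (Nat.mod_lt n hl).le
  have hnq' : (n : ℝ) = q * l + r := by exact_mod_cast hnq.symm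
  set S := ∑ q ∈ range q, (∑ j ∈ range l, u (q * l + j) - P) with hS
  have hsum : ∑ i ∈ range n, u i = S + q * P + ∑ i ∈ range r, u (q * l + i) := by
    conv_lhs => rw [← hnq]
    rw [sum_range_add, sum_range_mul_eq_sum_blocks, hS, sum_sub_distrib]
    simp
  have hdiff : (∑ i ∈ range n, u i) / n - P / l =
      (S + (∑ i ∈ range r, u (q * l + i) - r / l * P)) / n := by
    rw [hsum]
    field_simp
    rw [hnq']
    ring
  have hS' : |S| / n ≤ |(q : ℝ)⁻¹ * S| := by
    rw [abs_mul, abs_inv, Nat.abs_cast, inv_mul_eq_div]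
    refine div_le_div_of_nonneg_left (abs_nonneg _) hq0 ?_
    exact_mod_cast Nat.div_le_self n l
  have hrest : |∑ i ∈ range r, u (q * l + i) - r / l * P| ≤ l * B + |P| := by
    refine (abs_sub _ _).trans (add_le_add ?_ ?_)
    · exact (abs_sum_range_le (fun i => hB _) r).trans (by gcongr)
    · rw [abs_mul, abs_of_nonneg (by positivity)]
      exact mul_le_of_le_one_left (abs_nonneg _) ((div_le_one hl').2 hrl)
  rw [Real.norm_eq_abs, hdiff, abs_div, Nat.abs_cast]
  calc _ ≤ (|S| + (l * B + |P|)) / n := by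
        gcongr
        exact (abs_add_le _ _).trans (by gcongr)
    _ = |S| / n + (l * B + |P|) * (n : ℝ)⁻¹ := by rw [add_div, div_eq_mul_inv (l * B + |P|)]
    _ ≤ _ := by gcongr

theorem sum_range_sub_mul_by_parts (E F : ℕ → ℝ) (n : ℕ) :
    ∑ k ∈ range n, (E (k + 1) - E k) * F k =
      E n * F n - E 0 * F 0 + ∑ k ∈ range n, E (k + 1) * (F k - F (k + 1)) := by
  induction n with
  | zero => simp
  | succ n ih => rw [sum_range_succ, sum_range_succ, ih]; ring

/-- A sequence with affinely bounded partial sums, tested against a decreasing weight that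
vanishes at the end. -/
theorem abs_sum_mul_le_of_abs_partial_sum_le {e F : ℕ → ℝ} {ε C : ℝ} {M : ℕ}
    (he : ∀ k, |∑ i ∈ range k, e i| ≤ ε * k + C)
    (hF : ∀ k < M, F (k + 1) ≤ F k) (hFM : F M = 0) :
    |∑ k ∈ range M, e k * F k| ≤ ε * ∑ k ∈ range M, F k + C * F 0 := by
  have h1 := sum_range_sub_mul_by_parts (fun k => ∑ i ∈ range k, e i) F M
  have h2 := sum_range_sub_mul_by_parts (fun k => ε * k + C) F M
  simp only [sum_range_succ_sub_sum, hFM, range_zero, sum_empty, mul_zero, zero_mul, sub_zero,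
    zero_add] at h1
  have h3 : ∑ k ∈ range M, (ε * ((k + 1 : ℕ) : ℝ) + C - (ε * k + C)) * F k =
      ε * ∑ k ∈ range M, F k := by
    rw [mul_sum]
    refine sum_congr rfl fun k _ => ?_
    push_cast
    ring
  rw [h3, hFM] at h2
  have h4 : |∑ k ∈ range M, (∑ i ∈ range (k + 1), e i) * (F k - F (k + 1))| ≤
      ∑ k ∈ range M, (ε * ((k + 1 : ℕ) : ℝ) + C) * (F k - F (k + 1)) := by
    refine (abs_sum_le_sum_abs _ _).trans (sum_le_sum fun k hk => ?_)
    have h5 := sub_nonneg.2 (hF k (mem_range.1 hk))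
    rw [abs_mul, abs_of_nonneg h5]
    exact mul_le_mul_of_nonneg_right (he (k + 1)) h5
  rw [h1]
  simp only [Nat.cast_zero] at h2
  linarith

/-- A sequence with Cesàro mean `γ` stays within `ε n + C` of `γ n` after summation. -/
theorem exists_abs_sum_sub_le_of_tendsto_cesaro {g : ℕ → ℝ} {γ ε : ℝ} (hε : 0 < ε)
    (hg : Tendsto (fun n : ℕ => (∑ i ∈ range n, g i) / n) atTop (nhds γ)) :
    ∃ C, 0 ≤ C ∧ ∀ n : ℕ, |∑ i ∈ range n, (g i - γ)| ≤ ε * n + C := by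
  obtain ⟨K, hK⟩ := Metric.tendsto_atTop.1 hg ε hε
  refine ⟨∑ m ∈ range (K + 1), |∑ i ∈ range m, (g i - γ)|,
    sum_nonneg fun _ _ => abs_nonneg _, fun n => ?_⟩
  by_cases hn : n ∈ range (K + 1)
  · have h1 := single_le_sum (f := fun m => |∑ i ∈ range m, (g i - γ)|)
      (fun _ _ => abs_nonneg _) hn
    have h2 : 0 ≤ ε * n := by positivity
    linarith
  · rw [mem_range, not_lt] at hn
    have hn0 : (0 : ℝ) < n := by exact_mod_cast (Nat.succ_pos K).trans_le hn
    have h1 := hK n (by omega)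
    rw [Real.dist_eq] at h1
    have h2 : ∑ i ∈ range n, (g i - γ) = ((∑ i ∈ range n, g i) / n - γ) * n := by
      rw [sum_sub_distrib]
      field_simp
      simp [mul_comm]
    have h3 : 0 ≤ ∑ m ∈ range (K + 1), |∑ i ∈ range m, (g i - γ)| :=
      sum_nonneg fun _ _ => abs_nonneg _
    rw [h2, abs_mul, Nat.abs_cast]
    nlinarith

/-- If the convolution of `g` with `m ^ s`, `0 < s ≤ 1`, grows at most linearly, then `g` has
vanishing Cesàro mean. -/
theorem cesaro_limit_eq_zero_of_convolution_le {g : ℕ → ℝ} {γ s D : ℝ} (hs0 : 0 < s)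
    (hs1 : s ≤ 1)
    (hg : Tendsto (fun n : ℕ => (∑ i ∈ range n, g i) / n) atTop (nhds γ))
    (hD : ∀ M : ℕ, 0 < M → |∑ k ∈ range M, g k * ((M : ℝ) - k) ^ s| ≤ D * M) : γ = 0 := by
  by_contra hγ
  have hγ' : 0 < |γ| := abs_pos.2 hγ
  obtain ⟨C, hC0, hC⟩ := exists_abs_sum_sub_le_of_tendsto_cesaro (half_pos hγ') hg
  have hupper : ∀ M : ℕ, 0 < M →
      |γ| / 2 * ∑ k ∈ range M, ((M : ℝ) - k) ^ s ≤ (D + C) * M := by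
    intro M hM
    have hM1 : (1 : ℝ) ≤ M := by exact_mod_cast hM
    have h1 := abs_sum_mul_le_of_abs_partial_sum_le (F := fun k : ℕ => ((M : ℝ) - k) ^ s)
      (M := M) hC ?_ ?_
    · have h2 := hD M hM
      have h3 : 0 ≤ ∑ k ∈ range M, ((M : ℝ) - k) ^ s := sum_nonneg fun k hk => by
        have : (k : ℝ) < M := by exact_mod_cast mem_range.1 hk
        exact Real.rpow_nonneg (by linarith) _
      have h4 : ∑ k ∈ range M, (g k - γ) * ((M : ℝ) - k) ^ s =
          ∑ k ∈ range M, g k * ((M : ℝ) - k) ^ s - γ * ∑ k ∈ range M, ((M : ℝ) - k) ^ s := by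
        rw [mul_sum, ← sum_sub_distrib]
        exact sum_congr rfl fun k _ => by ring
      have h5 : |γ| * ∑ k ∈ range M, ((M : ℝ) - k) ^ s =
          |γ * ∑ k ∈ range M, ((M : ℝ) - k) ^ s| := by rw [abs_mul, abs_of_nonneg h3]
      have h6 : (M : ℝ) ^ s ≤ M := by
        simpa using Real.rpow_le_rpow_of_exponent_le hM1 hs1
      have h7 := abs_sub_abs_le_abs_sub (γ * ∑ k ∈ range M, ((M : ℝ) - k) ^ s)
        (∑ k ∈ range M, g k * ((M : ℝ) - k) ^ s)
      rw [abs_sub_comm (γ * _), ← h4, ← h5] at h7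
      simp only [Nat.cast_zero, sub_zero] at h1
      have h8 : C * (M : ℝ) ^ s ≤ C * M := by gcongr
      linarith
    · intro k hk
      have : ((k + 1 : ℕ) : ℝ) ≤ M := by exact_mod_cast hk
      refine Real.rpow_le_rpow (by linarith) ?_ hs0.le
      push_cast
      linarith
    · simp [Real.zero_rpow hs0.ne']
  have hw : Tendsto (fun m : ℕ => (m : ℝ) ^ s) atTop atTop :=
    (tendsto_rpow_atTop hs0).comp tendsto_natCast_atTop_atTop
  obtain ⟨K, hK⟩ := eventually_atTop.1
    (hw.eventually_ge_atTop (2 * (|D + C| + 1) * (2 / |γ|)))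
  have hR : 0 ≤ 2 * (|D + C| + 1) * (2 / |γ|) := by positivity
  set R := 2 * (|D + C| + 1) * (2 / |γ|) with hRdef
  have hlow : R * ((K + 1 : ℕ) : ℝ) ≤
      ∑ k ∈ range (2 * (K + 1)), (((2 * (K + 1) : ℕ) : ℝ) - k) ^ s := by
    have hsub : range (K + 1) ⊆ range (2 * (K + 1)) := range_subset_range.2 (by omega)
    refine le_trans ?_ (sum_le_sum_of_subset_of_nonneg hsub fun k hk _ => ?_)
    · have := card_nsmul_le_sum (range (K + 1))
        (fun k : ℕ => (((2 * (K + 1) : ℕ) : ℝ) - k) ^ s) R (fun k hk => by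
          have hk' := mem_range.1 hk
          have := hK (2 * (K + 1) - k) (by omega)
          rwa [Nat.cast_sub (by omega)] at this)
      simpa [mul_comm] using this
    · have : (k : ℝ) < ((2 * (K + 1) : ℕ) : ℝ) := by exact_mod_cast mem_range.1 hk
      exact Real.rpow_nonneg (by linarith) _
  have hup := hupper (2 * (K + 1)) (by omega)
  have h1 : |γ| / 2 * (R * ((K + 1 : ℕ) : ℝ)) ≤ (D + C) * ((2 * (K + 1) : ℕ) : ℝ) :=
    (mul_le_mul_of_nonneg_left hlow (by positivity)).trans hup
  have h2 : |γ| / 2 * R = 2 * (|D + C| + 1) := by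
    rw [hRdef]
    field_simp
  rw [← mul_assoc, h2] at h1
  push_cast at h1
  have h3 := le_abs_self (D + C)
  have h4 : (0 : ℝ) < K + 1 := by positivity
  nlinarith

/-- Tangent line inequality for the concave function `y ↦ y ^ s`. -/
theorem add_rpow_le_rpow_add_mul {s y h : ℝ} (hs0 : 0 ≤ s) (hs1 : s ≤ 1) (hy : 0 < y)
    (hyh : 0 ≤ y + h) : (y + h) ^ s ≤ y ^ s + s * h * y ^ (s - 1) := by
  have h1 : -1 ≤ h / y := by rw [le_div_iff₀ hy]; linarith
  have h2 := rpow_one_add_le_one_add_mul_self h1 hs0 hs1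
  have h3 : y + h = y * (1 + h / y) := by field_simp
  rw [h3, Real.mul_rpow hy.le (by linarith), Real.rpow_sub_one hy.ne']
  calc y ^ s * (1 + h / y) ^ s ≤ y ^ s * (1 + s * (h / y)) := by gcongr
    _ = _ := by ring

/-- The sums `∑_{i ≤ m} i ^ (s - 1)` differ from `m ^ s / s` by a convergent sequence. -/
theorem exists_tendsto_sum_rpow_sub_rpow_div {s : ℝ} (hs0 : 0 < s) (hs1 : s ≤ 1) :
    ∃ c, Tendsto (fun m : ℕ => ∑ i ∈ range m, ((i : ℝ) + 1) ^ (s - 1) - (m : ℝ) ^ s / s)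
      atTop (nhds c) := by
  have hanti : Antitone
      (fun m : ℕ => ∑ i ∈ range m, ((i : ℝ) + 1) ^ (s - 1) - (m : ℝ) ^ s / s) := by
    refine antitone_nat_of_succ_le fun m => ?_
    have h1 := add_rpow_le_rpow_add_mul (y := (m : ℝ) + 1) (h := -1) hs0.le hs1
      (by positivity) (by simp)
    rw [add_neg_cancel_right] at h1
    have h2 : (m : ℝ) ^ s / s ≤ ((m : ℝ) + 1) ^ s / s - ((m : ℝ) + 1) ^ (s - 1) := by
      rw [div_le_iff₀ hs0, sub_mul, div_mul_cancel₀ _ hs0.ne']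
      linarith
    rw [sum_range_succ]
    push_cast
    linarith
  have hlow : ∀ m : ℕ, (((m : ℝ) + 1) ^ s - 1) / s ≤ ∑ i ∈ range m, ((i : ℝ) + 1) ^ (s - 1) := by
    intro m
    induction m with
    | zero => simp
    | succ m ih =>
      have h1 := add_rpow_le_rpow_add_mul (y := (m : ℝ) + 1) (h := 1) hs0.le hs1
        (by positivity) (by positivity)
      rw [div_le_iff₀ hs0] at ih ⊢
      rw [sum_range_succ]
      push_cast
      linarith
  refine ⟨_, tendsto_atTop_ciInf hanti ⟨-(1 / s), ?_⟩⟩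
  rintro _ ⟨m, rfl⟩
  have h1 := hlow m
  have h2 : (m : ℝ) ^ s / s ≤ ((m : ℝ) + 1) ^ s / s := by
    gcongr
    linarith
  rw [sub_div] at h1
  simp only
  linarith

/-- Convolving a bounded sequence of vanishing Cesàro mean with a convergent sequence yields
`o(n)`. -/
theorem tendsto_convolution_div_zero {g d : ℕ → ℝ} {B c : ℝ} (hB : ∀ i, |g i| ≤ B)
    (hg : Tendsto (fun n : ℕ => (∑ i ∈ range n, g i) / n) atTop (nhds 0))
    (hd : Tendsto d atTop (nhds c)) :
    Tendsto (fun n : ℕ => (∑ k ∈ range n, g k * d (n - k)) / n) atTop (nhds 0) := by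
  have hB0 : 0 ≤ B := (abs_nonneg _).trans (hB 0)
  have hd0 : Tendsto (fun i : ℕ => |d (i + 1) - c|) atTop (nhds 0) := by
    have := ((hd.comp (tendsto_add_atTop_nat 1)).sub_const c).abs
    simpa [Function.comp_def] using this
  have hrest : Tendsto (fun n : ℕ => (∑ k ∈ range n, g k * (d (n - k) - c)) / n)
      atTop (nhds 0) := by
    have h1 := hd0.cesaro.const_mul B
    rw [mul_zero] at h1
    refine squeeze_zero_norm (fun n => ?_) h1
    rw [Real.norm_eq_abs, abs_div, Nat.abs_cast, inv_mul_eq_div, ← mul_div_assoc]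
    gcongr
    rw [← sum_range_reflect, mul_sum]
    refine (abs_sum_le_sum_abs _ _).trans (sum_le_sum fun k hk => ?_)
    have hk' := mem_range.1 hk
    rw [abs_mul, show n - (n - 1 - k) = k + 1 by omega]
    gcongr
    exact hB _
  have h2 := (hg.const_mul c).add hrest
  rw [mul_zero, zero_add] at h2
  refine h2.congr fun n => ?_
  rw [← mul_div_assoc, ← add_div, mul_sum, ← sum_add_distrib]
  congr 1
  exact sum_congr rfl fun k _ => by ring

theorem sum_range_convolution_eq (g w : ℕ → ℝ) (M : ℕ) :
    ∑ n ∈ range M, ∑ k ∈ range (n + 1), g k * w (n - k) =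
      ∑ k ∈ range M, g k * ∑ i ∈ range (M - k), w i := by
  induction M with
  | zero => simp
  | succ M ih =>
    have h1 : ∑ k ∈ range (M + 1), g k * ∑ i ∈ range (M + 1 - k), w i =
        ∑ k ∈ range (M + 1), (g k * ∑ i ∈ range (M - k), w i + g k * w (M - k)) := by
      refine sum_congr rfl fun k hk => ?_
      rw [Nat.succ_sub (Nat.lt_succ_iff.1 (mem_range.1 hk)), sum_range_succ]
      ring
    rw [h1, sum_add_distrib, sum_range_succ, ih,
      sum_range_succ (fun k => g k * ∑ i ∈ range (M - k), w i)]
    simp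

theorem tendsto_cesaro_of_tendsto_cesaro_succ {g : ℕ → ℝ} {γ : ℝ}
    (h : Tendsto (fun n : ℕ => (∑ i ∈ range n, g (i + 1)) / n) atTop (nhds γ)) :
    Tendsto (fun n : ℕ => (∑ i ∈ range n, g i) / n) atTop (nhds γ) := by
  rw [← tendsto_add_atTop_iff_nat 1]
  have h1 := (h.mul (tendsto_natCast_div_add_atTop (1 : ℝ))).add
    ((tendsto_one_div_add_atTop_nhds_zero_nat (𝕜 := ℝ)).const_mul (g 0))
  rw [mul_one, mul_zero, add_zero] at h1
  refine h1.congr' ?_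
  filter_upwards [eventually_gt_atTop 0] with n hn
  have hn0 : (0 : ℝ) < n := by exact_mod_cast hn
  rw [sum_range_succ']
  push_cast
  field_simp

/-- In fractional maps of orders `1 < α < 2`, the total of all physical momenta of
asymptotically period-`l` points is zero. -/
theorem sum_of_asymptotic_momenta_eq_zero
    (α : ℝ) (hα1 : 1 < α) (hα2 : α < 2)
    (G : ℝ → ℝ) (hG : Continuous G)
    (x p : ℕ → ℝ) (x0 p0 : ℝ)
    (hx0 : x 0 = x0) (hp0 : p 0 = p0)
    (hx : ∀ n : ℕ, x (n + 1) = x0 + p0 * ((n : ℝ) + 1)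
      - (1 / Real.Gamma α) * ∑ k ∈ range (n + 1), G (x k) * ((n : ℝ) - k + 1) ^ (α - 1))
    (hp : ∀ n : ℕ, p (n + 1) = p0
      - (1 / Real.Gamma (α - 1)) * ∑ k ∈ range (n + 1), G (x k) * ((n : ℝ) - k + 1) ^ (α - 2))
    (l : ℕ) (hl : 1 < l)
    (xlim plim : ℕ → ℝ)
    (hlim : ∀ j ∈ Icc 1 l,
      Tendsto (fun N : ℕ => x (N * l + j)) atTop (nhds (xlim j)) ∧
      Tendsto (fun N : ℕ => p (N * l + j)) atTop (nhds (plim j))) :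
    ∑ j ∈ Icc 1 l, plim j = 0 := by
  have hl0 : 0 < l := by omega
  set s := α - 1 with hs
  have hs0 : 0 < s := by linarith
  have hs1 : s ≤ 1 := by linarith
  have hα : α - 2 = s - 1 := by rw [hs]; ring
  have hΓ : Real.Gamma α = s * Real.Gamma s := by
    rw [← Real.Gamma_add_one hs0.ne', hs, sub_add_cancel]
  have hΓ0 : 0 < Real.Gamma s := Real.Gamma_pos_of_pos hs0
  have hlim' : ∀ j ∈ range l,
      Tendsto (fun N : ℕ => x (N * l + j + 1)) atTop (nhds (xlim (j + 1))) ∧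
      Tendsto (fun N : ℕ => p (N * l + j + 1)) atTop (nhds (plim (j + 1))) := fun j hj =>
    hlim (j + 1) (mem_Icc.2 ⟨by omega, mem_range.1 hj⟩)
  have hgl : ∀ j ∈ range l, Tendsto (fun N : ℕ => G (x (N * l + j + 1))) atTop
      (nhds (G (xlim (j + 1)))) := fun j hj =>
    (hG.tendsto _).comp (hlim' j hj).1
  obtain ⟨X, hX⟩ := exists_abs_le_of_tendsto_residues (u := fun i => x (i + 1))
    (a := fun j => xlim (j + 1)) hl0 fun j hj => (hlim' j hj).1
  obtain ⟨B, hB⟩ := exists_abs_le_of_tendsto_residues (u := fun i => G (x (i + 1)))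
    (a := fun j => G (xlim (j + 1))) hl0 hgl
  have hX0 : 0 ≤ X := (abs_nonneg _).trans (hX 0)
  have hB' : ∀ i, |G (x i)| ≤ max B |G (x 0)| := by
    rintro (_ | i)
    · exact le_max_right _ _
    · exact (hB i).trans (le_max_left _ _)
  have hxM : ∀ M : ℕ, 0 < M → x M = x0 + p0 * M
      - (1 / (s * Real.Gamma s)) * ∑ k ∈ range M, G (x k) * ((M : ℝ) - k) ^ s := by
    rintro (_ | n) hM
    · exact absurd hM (lt_irrefl 0)
    · rw [hx n, hΓ]
      push_cast
      congr 2
      exact sum_congr rfl fun k _ => by congr 2; ring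
  have hmean := tendsto_cesaro_of_tendsto_cesaro_succ (g := fun i => G (x i))
    (tendsto_cesaro_of_tendsto_residues (u := fun i => G (x (i + 1)))
      (a := fun j => G (xlim (j + 1))) hl0 hgl)
  have hγ := cesaro_limit_eq_zero_of_convolution_le
    (D := s * Real.Gamma s * (|x0| + |p0| + X)) hs0 hs1 hmean (fun M hM => by
      have hM1 : (1 : ℝ) ≤ M := by exact_mod_cast hM
      have h1 := hxM M hM
      have h2 : |x M| ≤ X := by
        obtain ⟨n, rfl⟩ := Nat.exists_eq_add_of_lt hM
        simpa using hX n
      have h3 : ∑ k ∈ range M, G (x k) * ((M : ℝ) - k) ^ s =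
          s * Real.Gamma s * (x0 + p0 * M - x M) := by
        rw [h1]
        field_simp
        ring
      rw [h3, abs_mul, abs_of_pos (by positivity), mul_assoc (s * Real.Gamma s)]
      refine mul_le_mul_of_nonneg_left ?_ (by positivity)
      have h4 : |x0 + p0 * M - x M| ≤ |x0| + |p0| * M + |x M| := by
        refine (abs_sub _ _).trans ?_
        gcongr
        refine (abs_add_le _ _).trans ?_
        rw [abs_mul, Nat.abs_cast]
      nlinarith [abs_nonneg x0, abs_nonneg p0])
  rw [hγ] at hmean
  obtain ⟨c, hc⟩ := exists_tendsto_sum_rpow_sub_rpow_div hs0 hs1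
  have hconv := tendsto_convolution_div_zero hB' hmean hc
  have hpsum : ∀ M : ℕ, 0 < M → ∑ n ∈ range M, p (n + 1) = x M - x0
      - (1 / Real.Gamma s) * ∑ k ∈ range M, G (x k) *
        (∑ i ∈ range (M - k), ((i : ℝ) + 1) ^ (s - 1) - ((M - k : ℕ) : ℝ) ^ s / s) := by
    intro M hM
    have h1 : ∀ n, p (n + 1) = p0 - (1 / Real.Gamma s) *
        ∑ k ∈ range (n + 1), G (x k) * (((n - k : ℕ) : ℝ) + 1) ^ (s - 1) := by
      intro n
      rw [hp n, hα]
      congr 2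
      refine sum_congr rfl fun k hk => ?_
      rw [Nat.cast_sub (Nat.lt_succ_iff.1 (mem_range.1 hk))]
    have h2 : ∑ k ∈ range M, G (x k) *
        (∑ i ∈ range (M - k), ((i : ℝ) + 1) ^ (s - 1) - ((M - k : ℕ) : ℝ) ^ s / s) =
        ∑ k ∈ range M, G (x k) * ∑ i ∈ range (M - k), ((i : ℝ) + 1) ^ (s - 1) -
          (∑ k ∈ range M, G (x k) * ((M : ℝ) - k) ^ s) / s := by
      rw [sum_div, ← sum_sub_distrib]
      refine sum_congr rfl fun k hk => ?_
      rw [Nat.cast_sub (mem_range.1 hk).le]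
      ring
    rw [sum_congr rfl fun n _ => h1 n, sum_sub_distrib, ← mul_sum,
      sum_range_convolution_eq (fun k => G (x k)) (fun i => ((i : ℝ) + 1) ^ (s - 1)), h2,
      hxM M hM, sum_const, card_range, nsmul_eq_mul]
    field_simp
    ring
  have hces := tendsto_cesaro_of_tendsto_residues (u := fun i => p (i + 1))
    (a := fun j => plim (j + 1)) hl0 fun j hj => (hlim' j hj).2
  have hxdiv : Tendsto (fun M : ℕ => (x M - x0) / M) atTop (nhds 0) := by
    have h1 := (tendsto_inv_atTop_nhds_zero_nat (𝕜 := ℝ)).const_mul (X + |x0|)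
    rw [mul_zero] at h1
    refine squeeze_zero_norm' ?_ h1
    filter_upwards [eventually_gt_atTop 0] with M hM
    obtain ⟨n, rfl⟩ := Nat.exists_eq_add_of_lt hM
    rw [Real.norm_eq_abs, abs_div, Nat.abs_cast, div_eq_mul_inv]
    gcongr
    refine (abs_sub _ _).trans ?_
    gcongr
    simpa using hX n
  have hzero := hxdiv.sub (hconv.const_mul (1 / Real.Gamma s))
  rw [mul_zero, sub_zero] at hzero
  have hP := tendsto_nhds_unique hces (hzero.congr' (by
    filter_upwards [eventually_gt_atTop 0] with M hM
    rw [hpsum M hM, sub_div (x M - x0), mul_div_assoc (1 / Real.Gamma s)]))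
  have hl' : (l : ℝ) ≠ 0 := by exact_mod_cast hl0.ne'
  rw [div_eq_zero_iff, or_iff_left hl'] at hP
  rw [← hP, range_eq_Ico, sum_Ico_add' plim 0 l 1]
  rfl
end

section
/- Let 0 < α < 1 and let U_α(n) = Γ(n+α−1)/Γ(n) for integers n ≥ 1 and U_α(n) = 0 for n ≤ 0. For every integer n ≥ 1 and every integer p with 1 ≤ p ≤ 2n, the sum S_{p,2n} := Σ_{k=0}^{∞} [U_α(2nk+p−1) − U_α(2nk+p)] converges and equals (Γ(α)·2^{−α}/n)·(−1)^p·[1 + 2 Σ_{j=1}^{n−1} (cos(πj/(2n)))^{1−α} · cos(πj(2p+α−3)/(2n))]. -/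
open Finset Real

lemma Ring.choose_succ_mul_succ (a : ℝ) (m : ℕ) :
    Ring.choose a (m + 1) * (m + 1) = Ring.choose a m * (a - m) := by
  simp only [Ring.choose_eq_smul, descPochhammer_succ_right, Polynomial.smeval_mul,
    Polynomial.smeval_sub, Polynomial.smeval_X, Polynomial.smeval_natCast, Nat.factorial_succ,
    smul_eq_mul]
  have : (m.factorial : ℝ) ≠ 0 := by exact_mod_cast m.factorial_ne_zero
  have : (m : ℝ) + 1 ≠ 0 := by positivity
  push_cast
  field_simp
  simp

/-- If the binomial series of exponent `a > 0` converges absolutely at radius `1`, it represents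
`(1 - z) ^ a` on the closed unit disk. -/
lemma hasSum_choose_mul_pow_of_norm_le_one {a : ℝ} (ha : 0 < a)
    (hs : Summable fun m : ℕ => (-1 : ℝ) ^ m * Ring.choose a m) {z : ℂ} (hz : ‖z‖ ≤ 1) :
    HasSum (fun m : ℕ => (((-1 : ℝ) ^ m * Ring.choose a m : ℝ) : ℂ) * z ^ m)
      ((1 - z) ^ (a : ℂ)) := by
  set b : ℕ → ℝ := fun m => (-1 : ℝ) ^ m * Ring.choose a m with hb
  have hbound : ∀ (m : ℕ) (w : ℂ), w ∈ Metric.closedBall (0 : ℂ) 1 →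
      ‖(b m : ℂ) * w ^ m‖ ≤ ‖b m‖ := by
    intro m w hw
    rw [norm_mul, norm_pow, Complex.norm_real]
    exact mul_le_of_le_one_right (norm_nonneg _)
      (pow_le_one₀ (norm_nonneg _) (by simpa using hw))
  have hsum : ∀ w ∈ Metric.closedBall (0 : ℂ) 1, Summable fun m => (b m : ℂ) * w ^ m :=
    fun w hw => Summable.of_norm_bounded hs.norm fun m => hbound m w hw
  have hcont : ContinuousOn (fun w : ℂ => ∑' m, (b m : ℂ) * w ^ m) (Metric.closedBall 0 1) :=
    continuousOn_tsum (fun m => by fun_prop) hs.norm hbound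
  have hcpow : ContinuousOn (fun w : ℂ => (1 - w) ^ (a : ℂ)) (Metric.closedBall 0 1) := by
    intro w hw
    apply ContinuousAt.continuousWithinAt
    by_cases h : w = 1
    · subst h
      have h0 := Complex.continuousAt_cpow_zero_of_re_pos (z := (a : ℂ)) (by simpa using ha)
      have h1 : ContinuousAt (fun w : ℂ => ((1 - w, (a : ℂ)) : ℂ × ℂ)) 1 := by fun_prop
      exact ContinuousAt.comp (f := fun w : ℂ => ((1 - w, (a : ℂ)) : ℂ × ℂ))
        (g := fun x : ℂ × ℂ => x.1 ^ x.2) (by simpa using h0) h1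
    · refine ContinuousAt.cpow (by fun_prop) (by fun_prop) ?_
      have hre : w.re ≤ 1 := (Complex.re_le_norm w).trans (by simpa using hw)
      rcases hre.lt_or_eq with h1 | h1
      · exact Or.inl (by simpa using h1)
      · right
        simp only [Complex.sub_im, Complex.one_im, zero_sub, ne_eq, neg_eq_zero]
        intro him
        exact h (Complex.ext h1 him)
  have heq : Set.EqOn (fun w : ℂ => ∑' m, (b m : ℂ) * w ^ m)
      (fun w : ℂ => (1 - w) ^ (a : ℂ)) (Metric.ball 0 1) := by
    intro w hw
    have h := (Complex.one_add_cpow_hasFPowerSeriesOnBall_zero (a := (a : ℂ))).hasSum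
      (y := -w) (by simpa [← ENNReal.ofReal_one, Metric.eball_ofReal] using hw)
    simp only [binomialSeries_apply, zero_add] at h
    simp only [sub_eq_add_neg, ← h.tsum_eq]
    refine tsum_congr fun m => ?_
    rw [List.ofFn_const, List.prod_replicate, neg_pow, ← Complex.ofReal_choose]
    simp [hb]
    ring
  have hmem : z ∈ Metric.closedBall (0 : ℂ) 1 := by simpa using hz
  have := heq.of_subset_closure hcont hcpow Metric.ball_subset_closedBall
    (by rw [closure_ball _ one_ne_zero]) hmem
  simp only at this
  rw [← this]
  exact (hsum z hmem).hasSum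

lemma IsPrimitiveRoot.sum_range_pow_mul_zpow {ζ : ℂ} {N : ℕ} (hζ : IsPrimitiveRoot ζ N)
    (m : ℤ) : ∑ i ∈ range N, (ζ ^ i) ^ m = if (N : ℤ) ∣ m then (N : ℂ) else 0 := by
  have hcomm : ∀ i : ℕ, (ζ ^ i) ^ m = (ζ ^ m) ^ i := fun i => by
    rw [← zpow_natCast, ← zpow_natCast, ← zpow_mul, ← zpow_mul, mul_comm]
  simp only [hcomm]
  split_ifs with h
  · simp [(hζ.zpow_eq_one_iff_dvd m).2 h]
  · have h1 : ζ ^ m ≠ 1 := fun h' => h ((hζ.zpow_eq_one_iff_dvd m).1 h')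
    rw [geom_sum_eq h1, ← hcomm, hζ.pow_eq_one]
    simp

/-- Extraction of an arithmetic progression from a power series by averaging over roots of
unity. -/
lemma IsPrimitiveRoot.hasSum_arithmetic_progression {ζ : ℂ} {N q : ℕ} (hζ : IsPrimitiveRoot ζ N)
    (hq : q < N) {c : ℕ → ℂ} {F : ℂ → ℂ}
    (hF : ∀ i ∈ range N, HasSum (fun m => c m * (ζ ^ i) ^ m) (F (ζ ^ i))) :
    HasSum (fun k : ℕ => c (N * k + q))
      ((∑ i ∈ range N, F (ζ ^ i) * (ζ ^ i) ^ (-(q : ℤ))) / N) := by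
  have hN : (N : ℂ) ≠ 0 := by exact_mod_cast (by omega : N ≠ 0)
  have hζ0 : ζ ≠ 0 := hζ.ne_zero (by omega)
  have h := (hasSum_sum fun i hi => (hF i hi).mul_right ((ζ ^ i) ^ (-(q : ℤ)))).div_const (N : ℂ)
  have hfun : (fun m => (∑ i ∈ range N, c m * (ζ ^ i) ^ m * (ζ ^ i) ^ (-(q : ℤ))) / (N : ℂ)) =
      fun m : ℕ => if (N : ℤ) ∣ (m : ℤ) - q then c m else 0 := by
    funext m
    have : ∀ i ∈ range N, c m * (ζ ^ i) ^ m * (ζ ^ i) ^ (-(q : ℤ)) =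
        c m * (ζ ^ i) ^ ((m : ℤ) - q) := fun i _ => by
      rw [sub_eq_add_neg, zpow_add₀ (pow_ne_zero _ hζ0), zpow_natCast, mul_assoc]
    rw [sum_congr rfl this, ← mul_sum, hζ.sum_range_pow_mul_zpow]
    split_ifs <;> simp [hN]
  rw [hfun] at h
  have hinj : Function.Injective fun k : ℕ => N * k + q := fun x y hxy =>
    Nat.eq_of_mul_eq_mul_left (by omega : 0 < N) (Nat.add_right_cancel hxy)
  rw [← hinj.hasSum_iff] at h
  · refine h.congr_fun ?_
    intro k
    simp
  · intro m hm
    rw [if_neg]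
    rintro ⟨k, hk⟩
    have hk0 : 0 ≤ k := by
      by_contra! hneg
      nlinarith
    lift k to ℕ using hk0
    exact hm ⟨k, by simp only; zify; linarith⟩

lemma sum_range_two_mul_eq_add_sum_symm {M : Type*} [AddCommMonoid M] (f : ℕ → M) {n : ℕ}
    (hn : 1 ≤ n) : ∑ i ∈ range (2 * n), f i =
      f 0 + (f n + ∑ j ∈ Icc 1 (n - 1), (f (n - j) + f (n + j))) := by
  have hIcc : Icc 1 (n - 1) = Ico 1 n := by ext; simp; omega
  rw [hIcc, sum_add_distrib, sum_Ico_reflect f 1 (by omega), Nat.add_sub_cancel_left,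
    Nat.add_sub_cancel, two_mul, sum_range_add, range_eq_Ico, sum_eq_sum_Ico_succ_bot (by omega),
    sum_eq_sum_Ico_succ_bot (by omega : 0 < n)]
  simp only [zero_add, add_zero]
  abel

/-- The generating function `(1 - z) ^ a` at `z = -e^{2iθ}`. -/
lemma one_add_exp_cpow {θ a : ℝ} (h1 : -(π / 2) < θ) (h2 : θ < π / 2) :
    (1 + Complex.exp (2 * θ * Complex.I)) ^ (a : ℂ) =
      (((2 * Real.cos θ) ^ a : ℝ) : ℂ) * Complex.exp (a * θ * Complex.I) := by
  have hcos : 0 < Real.cos θ := Real.cos_pos_of_mem_Ioo ⟨h1, h2⟩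
  have hfac : 1 + Complex.exp (2 * θ * Complex.I) =
      ((2 * Real.cos θ : ℝ) : ℂ) * Complex.exp (θ * Complex.I) := by
    push_cast
    rw [Complex.two_cos, add_mul, ← Complex.exp_add, ← Complex.exp_add]
    ring_nf
    simp [add_comm]
  have hpi := Real.pi_pos
  have hlog : Complex.log (Complex.exp (θ * Complex.I)) = θ * Complex.I :=
    Complex.log_exp (by simp; linarith) (by simp; linarith)
  rw [Complex.ofReal_cpow (by positivity), hfac, Complex.cpow_def_of_ne_zero
    (mul_ne_zero (by exact_mod_cast (by positivity : 2 * Real.cos θ ≠ 0)) (Complex.exp_ne_zero _)),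
    Complex.log_ofReal_mul (by positivity) (Complex.exp_ne_zero _), hlog,
    Complex.cpow_def_of_ne_zero (by exact_mod_cast (by positivity : 2 * Real.cos θ ≠ 0)),
    ← Complex.ofReal_log (by positivity), ← Complex.exp_add]
  ring_nf

lemma fallingFactorialKernel_sub_succ {α : ℝ} (hα0 : 0 < α) {U : ℤ → ℝ}
    (hU1 : ∀ m : ℤ, 1 ≤ m → U m = Real.Gamma ((m : ℝ) + α - 1) / Real.Gamma (m : ℝ)) (k : ℕ) :
    U (k + 1) - U (k + 1 + 1) = U (k + 1) * ((1 - α) / (k + 1)) := by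
  have hk : (0 : ℝ) < k + 1 := by positivity
  have hkα : (k : ℝ) + α ≠ 0 := by positivity
  have hG := (Real.Gamma_pos_of_pos hk).ne'
  rw [hU1 _ (by omega), hU1 _ (by omega)]
  push_cast
  rw [show (k : ℝ) + 1 + 1 + α - 1 = (k + α) + 1 by ring,
    show (k : ℝ) + 1 + α - 1 = k + α by ring, Real.Gamma_add_one hkα,
    Real.Gamma_add_one (s := (k : ℝ) + 1) hk.ne']
  field_simp
  ring

/-- The binomial coefficients of exponent `1 - α` are, up to sign and scale, the increments of
the falling-factorial kernel of order `α`. -/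
lemma fallingFactorialKernel_sub_eq {α : ℝ} (hα0 : 0 < α) {U : ℤ → ℝ}
    (hU1 : ∀ m : ℤ, 1 ≤ m → U m = Real.Gamma ((m : ℝ) + α - 1) / Real.Gamma (m : ℝ))
    (hU0 : ∀ m : ℤ, m ≤ 0 → U m = 0) (m : ℕ) :
    U m - U (m + 1) = -Real.Gamma α * ((-1) ^ m * Ring.choose (1 - α) m) := by
  have hrec := fallingFactorialKernel_sub_succ hα0 hU1
  induction m with
  | zero => simp [hU0 0 le_rfl, hU1 1 le_rfl]
  | succ m ih =>
    have hm : (0 : ℝ) < m + 1 := by positivity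
    have hchoose : Ring.choose (1 - α) (m + 1) =
        Ring.choose (1 - α) m * (1 - α - m) / (m + 1) := by
      rw [← Ring.choose_succ_mul_succ, mul_div_cancel_right₀ _ hm.ne']
    suffices h : U (m + 1) - U (m + 1 + 1) = (U m - U (m + 1)) * ((m - (1 - α)) / (m + 1)) by
      push_cast
      rw [h, ih, hchoose]
      ring
    rw [hrec]
    cases m with
    | zero => simp [hU0 0 le_rfl]; ring
    | succ k =>
      have h := hrec k
      have hk : (0 : ℝ) < k + 1 := by positivity
      push_cast at hm ⊢
      rw [h, show U (k + 1 + 1) = U (k + 1) * (1 - (1 - α) / (k + 1)) by linarith]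
      field_simp

lemma summable_fallingFactorialKernel_sub {α : ℝ} (hα0 : 0 < α) (hα1 : α < 1) {U : ℤ → ℝ}
    (hU1 : ∀ m : ℤ, 1 ≤ m → U m = Real.Gamma ((m : ℝ) + α - 1) / Real.Gamma (m : ℝ)) :
    Summable fun m : ℕ => U m - U (m + 1) := by
  have hU_nonneg : ∀ k : ℕ, 0 ≤ U (k + 1) := by
    intro k
    rw [hU1 _ (by omega)]
    push_cast
    exact div_nonneg (Real.Gamma_nonneg_of_nonneg (by linarith [k.cast_nonneg (α := ℝ)]))
      (Real.Gamma_nonneg_of_nonneg (by positivity))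
  have hanti : ∀ k : ℕ, 0 ≤ U (k + 1) - U (k + 1 + 1) := by
    intro k
    rw [fallingFactorialKernel_sub_succ hα0 hU1]
    exact mul_nonneg (hU_nonneg k) (div_nonneg (by linarith) (by positivity))
  rw [← summable_nat_add_iff 1]
  refine summable_of_sum_range_le (c := U 1) (fun k => by exact_mod_cast hanti k) fun N => ?_
  have htel := sum_range_sub' (fun k : ℕ => U (k + 1)) N
  push_cast at htel ⊢
  rw [htel]
  simpa using hU_nonneg N

/-- Closed-form evaluation of the sums `S_{p,2n}` for the falling-factorial kernel
`U_α(m) = Γ(m+α−1)/Γ(m)` (`m ≥ 1`), `U_α(m) = 0` (`m ≤ 0`), of order `0 < α < 1`: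
for `n ≥ 1` and `1 ≤ p ≤ 2n`,
`S_{p,2n} = Σ_{k=0}^∞ [U_α(2nk+p−1) − U_α(2nk+p)]` converges and equals
`(Γ(α)·2^{−α}/n)·(−1)^p·[1 + 2 Σ_{j=1}^{n−1} (cos(πj/(2n)))^{1−α} cos(πj(2p+α−3)/(2n))]`. -/
theorem S_p_even_closed_form
    (α : ℝ) (hα0 : 0 < α) (hα1 : α < 1)
    (U : ℤ → ℝ)
    (hU1 : ∀ m : ℤ, 1 ≤ m → U m = Real.Gamma ((m : ℝ) + α - 1) / Real.Gamma (m : ℝ))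
    (hU0 : ∀ m : ℤ, m ≤ 0 → U m = 0)
    (n : ℕ) (hn : 1 ≤ n) (p : ℕ) (hp1 : 1 ≤ p) (hp2 : p ≤ 2 * n) :
    HasSum (fun k : ℕ => U (2 * (n : ℤ) * k + p - 1) - U (2 * (n : ℤ) * k + p))
      ((Real.Gamma α * (2 : ℝ) ^ (-α) / n) * (-1 : ℝ) ^ p *
        (1 + 2 * ∑ j ∈ Icc 1 (n - 1),
          (Real.cos (π * j / (2 * n))) ^ (1 - α) *
            Real.cos (π * j * (2 * p + α - 3) / (2 * n)))) := by
  have hpi := Real.pi_pos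
  have hn0 : (0 : ℝ) < n := by exact_mod_cast hn
  have hG := Real.Gamma_pos_of_pos hα0
  obtain ⟨q, rfl⟩ := Nat.exists_eq_add_of_le' hp1
  have hcoef := fallingFactorialKernel_sub_eq hα0 hU1 hU0
  have hs : Summable fun m : ℕ => (-1 : ℝ) ^ m * Ring.choose (1 - α) m := by
    have h := summable_fallingFactorialKernel_sub hα0 hα1 hU1
    simp only [hcoef] at h
    exact (summable_mul_left_iff (neg_ne_zero.2 hG.ne')).1 h
  set ζ : ℂ := Complex.exp (2 * π * Complex.I / (2 * n : ℕ)) with hζ_def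
  have hζ : IsPrimitiveRoot ζ (2 * n) := Complex.isPrimitiveRoot_exp _ (by omega)
  set F : ℂ → ℂ := fun w => -Real.Gamma α * (1 - w) ^ ((1 - α : ℝ) : ℂ) with hF_def
  have hF : ∀ i ∈ range (2 * n), HasSum
      (fun m : ℕ => ((U m - U (m + 1) : ℝ) : ℂ) * (ζ ^ i) ^ m) (F (ζ ^ i)) := by
    intro i _
    have hnorm : ‖ζ ^ i‖ ≤ 1 := by rw [norm_pow, hζ.norm'_eq_one (by omega), one_pow]
    refine ((hasSum_choose_mul_pow_of_norm_le_one (by linarith) hs hnorm).mul_left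
      (-(Real.Gamma α : ℂ))).congr_fun fun m => ?_
    rw [hcoef]
    push_cast
    ring
  have key := hζ.hasSum_arithmetic_progression (q := q) (by omega) hF
  set κ : ℝ := 2 * (q + 1 : ℕ) + α - 3 with hκ
  set G : ℝ → ℂ := fun θ => (((2 * Real.cos θ) ^ (1 - α) : ℝ) : ℂ) *
    Complex.exp (-(κ * θ) * Complex.I) with hG_def
  have hterm : ∀ (i : ℕ) (t : ℝ), (i : ℝ) = n + t → |t| < n →
      F (ζ ^ i) * (ζ ^ i) ^ (-(q : ℤ)) =
        Real.Gamma α * (-1) ^ (q + 1) * G (π * t / (2 * n)) := by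
    intro i t hit ht
    obtain ⟨ht1, ht2⟩ := abs_lt.1 ht
    set θ : ℝ := π * t / (2 * n) with hθ
    have hθ1 : -(π / 2) < θ := by
      rw [hθ, lt_div_iff₀ (by positivity)]
      nlinarith
    have hθ2 : θ < π / 2 := by
      rw [hθ, div_lt_iff₀ (by positivity)]
      nlinarith
    have hroot : ζ ^ i = -Complex.exp (2 * θ * Complex.I) := by
      have hn' : (n : ℂ) ≠ 0 := by exact_mod_cast hn0.ne'
      have hic : (i : ℂ) = n + t := by exact_mod_cast congrArg (fun x : ℝ => (x : ℂ)) hit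
      rw [hζ_def, ← Complex.exp_nat_mul, hic, ← neg_one_mul, ← Complex.exp_pi_mul_I,
        ← Complex.exp_add, hθ]
      congr 1
      push_cast
      field_simp
    have hpow : (ζ ^ i) ^ (-(q : ℤ)) = (-1) ^ q * Complex.exp (-(2 * q * θ) * Complex.I) := by
      rw [zpow_neg, zpow_natCast, hroot, neg_pow, mul_inv, ← Complex.exp_nat_mul,
        ← Complex.exp_neg, ← inv_pow, inv_neg_one]
      ring_nf
    simp only [hF_def, hG_def]
    rw [hpow, hroot, sub_neg_eq_add, one_add_exp_cpow hθ1 hθ2,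
      show (-(κ * θ) * Complex.I : ℂ) =
        ((1 - α : ℝ) : ℂ) * θ * Complex.I + -(2 * q * θ) * Complex.I by
          rw [hκ]; push_cast; ring,
      Complex.exp_add]
    ring
  have hpair : ∀ j ∈ Icc 1 (n - 1),
      F (ζ ^ (n - j)) * (ζ ^ (n - j)) ^ (-(q : ℤ)) + F (ζ ^ (n + j)) * (ζ ^ (n + j)) ^ (-(q : ℤ)) =
        ((Real.Gamma α * (-1) ^ (q + 1) * (2 ^ (1 - α) * (2 * (Real.cos (π * j / (2 * n)) ^ (1 - α) *
          Real.cos (π * j * κ / (2 * n))))) : ℝ) : ℂ) := by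
    intro j hj
    obtain ⟨hj1, hj2⟩ := mem_Icc.1 hj
    have hjn : (j : ℝ) < n := by exact_mod_cast (by omega : j < n)
    have hcos : 0 ≤ Real.cos (π * j / (2 * n)) := by
      refine Real.cos_nonneg_of_neg_pi_div_two_le_of_le ?_ ?_
      · have : 0 ≤ π * j / (2 * n) := by positivity
        linarith
      · rw [div_le_iff₀ (by positivity)]
        nlinarith
    rw [hterm (n - j) (-j) (by rw [Nat.cast_sub (by omega)]; ring) (by simpa using hjn),
      hterm (n + j) j (by push_cast; ring) (by simpa using hjn)]
    simp only [hG_def]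
    rw [show π * -(j : ℝ) / (2 * n) = -(π * j / (2 * n)) by ring, Real.cos_neg,
      Real.mul_rpow (by norm_num) hcos,
      show π * j * κ / (2 * n) = κ * (π * j / (2 * n)) by ring]
    generalize π * (j : ℝ) / (2 * n) = θ
    have h2 := Complex.two_cos ((κ * θ : ℝ) : ℂ)
    push_cast at h2 ⊢
    rw [show (2 : ℂ) * (((Real.cos θ ^ (1 - α) : ℝ) : ℂ) * Complex.cos (κ * θ)) =
      ((Real.cos θ ^ (1 - α) : ℝ) : ℂ) * (2 * Complex.cos (κ * θ)) by ring, h2]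
    ring_nf
  rw [sum_range_two_mul_eq_add_sum_symm _ hn, sum_congr rfl hpair,
    hterm n 0 (by simp) (by simpa using hn0)] at key
  have hzero : F (ζ ^ 0) * (ζ ^ 0) ^ (-(q : ℤ)) = 0 := by
    have : ((1 - α : ℝ) : ℂ) ≠ 0 := by exact_mod_cast (by linarith : 1 - α ≠ 0)
    simp only [hF_def, pow_zero, sub_self, Complex.zero_cpow this, mul_zero, zero_mul]
  rw [hzero] at key
  rw [← Complex.hasSum_ofReal]
  convert key using 1
  · funext k
    push_cast
    ring_nf
  · have h2 : (2 : ℝ) ^ (1 - α) = 2 * 2 ^ (-α) := by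
      rw [sub_eq_add_neg, Real.rpow_add two_pos, Real.rpow_one]
    have hG0 : G (π * 0 / (2 * n)) = ((2 ^ (1 - α) : ℝ) : ℂ) := by simp [hG_def]
    rw [hG0, ← Complex.ofReal_sum, ← mul_sum, ← mul_sum, ← mul_sum, h2]
    generalize ∑ j ∈ Icc 1 (n - 1), Real.cos (π * j / (2 * n)) ^ (1 - α) *
      Real.cos (π * j * κ / (2 * n)) = T
    norm_cast
    push_cast
    field_simp
    ring
end

section
/- Let 0 < α < 1 and let U_α(n) = Γ(n+α−1)/Γ(n) for integers n ≥ 1 and U_α(n) = 0 for n ≤ 0. For every integer n ≥ 0 and every integer p with 1 ≤ p ≤ 2n+1, the sum S_{p,2n+1} := Σ_{k=0}^{∞} [U_α((2n+1)k+p−1) − U_α((2n+1)k+p)] converges and equals (2^{2−α}Γ(α)/(2n+1))·(−1)^p · Σ_{j=0}^{n−1} (cos(π(2j+1)/(2(2n+1))))^{1−α} · (−1)^j · sin(π(2j+1)(2p+2n−2+α)/(2(2n+1))). -/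
open Finset Real

theorem ring_choose_succ_mul (r : ℝ) (m : ℕ) :
    Ring.choose r (m + 1) * (m + 1) = Ring.choose r m * (r - m) := by
  have hm : (m.factorial : ℝ) ≠ 0 := by positivity
  simp only [Ring.choose_eq_smul, descPochhammer_succ_right, Polynomial.smeval_mul,
    Polynomial.smeval_sub, Polynomial.smeval_X, Polynomial.smeval_natCast, Nat.factorial_succ,
    smul_eq_mul, Nat.cast_mul, Nat.cast_add, Nat.cast_one, pow_one, pow_zero, nsmul_eq_mul, mul_one]
  field_simp

theorem sum_range_neg_one_pow_mul_ring_choose (a : ℝ) (m : ℕ) :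
    ∑ i ∈ range (m + 1), (-1 : ℝ) ^ i * Ring.choose a i = (-1) ^ m * Ring.choose (a - 1) m := by
  induction m with
  | zero => simp
  | succ m ih =>
    have h := Ring.choose_succ_succ (a - 1) m
    rw [sub_add_cancel] at h
    rw [sum_range_succ, ih, h]
    ring

theorem neg_one_pow_mul_ring_choose_neg_nonneg {b : ℝ} (hb : 0 ≤ b) (m : ℕ) :
    0 ≤ (-1 : ℝ) ^ m * Ring.choose (-b) m := by
  induction m with
  | zero => simp
  | succ m ih =>
    have h := ring_choose_succ_mul (-b) m
    have hm : (0 : ℝ) < m + 1 := by positivity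
    refine nonneg_of_mul_nonneg_left (b := (m + 1 : ℝ)) ?_ hm
    have : (-1 : ℝ) ^ (m + 1) * Ring.choose (-b) (m + 1) * (m + 1) =
        ((-1) ^ m * Ring.choose (-b) m) * (b + m) := by
      rw [mul_assoc, h]; ring
    rw [this]
    positivity

theorem neg_one_pow_mul_ring_choose_succ_nonpos {a : ℝ} (ha0 : 0 ≤ a) (ha1 : a ≤ 1) (m : ℕ) :
    (-1 : ℝ) ^ (m + 1) * Ring.choose a (m + 1) ≤ 0 := by
  have h := ring_choose_succ_mul (a - 1) m
  have hs := Ring.choose_succ_succ (a - 1) m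
  rw [sub_add_cancel] at hs
  have hm : (0 : ℝ) < m + 1 := by positivity
  have h0 := neg_one_pow_mul_ring_choose_neg_nonneg (sub_nonneg.2 ha1) m
  rw [neg_sub] at h0
  have : (-1 : ℝ) ^ (m + 1) * Ring.choose a (m + 1) * (m + 1) =
      -(((-1) ^ m * Ring.choose (a - 1) m) * a) := by
    rw [hs, mul_assoc, add_mul, h]; ring
  refine nonpos_of_mul_nonpos_left (b := (m + 1 : ℝ)) ?_ hm
  rw [this]
  have := mul_nonneg h0 ha0
  linarith

theorem summable_ring_choose {a : ℝ} (ha0 : 0 ≤ a) (ha1 : a ≤ 1) :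
    Summable fun i : ℕ ↦ |Ring.choose a i| := by
  rw [← summable_nat_add_iff 1]
  have habs (i : ℕ) : |Ring.choose a (i + 1)| = -((-1 : ℝ) ^ (i + 1) * Ring.choose a (i + 1)) := by
    rw [← abs_of_nonpos (neg_one_pow_mul_ring_choose_succ_nonpos ha0 ha1 i)]
    simp [abs_mul]
  refine summable_of_sum_range_le (c := 1) (fun _ ↦ abs_nonneg _) fun m ↦ ?_
  have h := sum_range_neg_one_pow_mul_ring_choose a m
  rw [sum_range_succ', pow_zero, Ring.choose_zero_right] at h
  have h0 := neg_one_pow_mul_ring_choose_neg_nonneg (sub_nonneg.2 ha1) m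
  rw [neg_sub] at h0
  simp only [habs, sum_neg_distrib]
  linarith

/-- The binomial series of `(1 - z) ^ a` converges on the closed unit disk when `0 < a ≤ 1`. -/
theorem hasSum_one_sub_cpow {a : ℝ} (ha0 : 0 < a) (ha1 : a ≤ 1) {z : ℂ} (hz : ‖z‖ ≤ 1) :
    HasSum (fun i : ℕ ↦ (((-1 : ℝ) ^ i * Ring.choose a i : ℝ) : ℂ) * z ^ i)
      ((1 - z) ^ (a : ℂ)) := by
  set f : ℕ → ℝ → ℂ := fun i r ↦ (((-1 : ℝ) ^ i * Ring.choose a i : ℝ) : ℂ) * (r * z) ^ i with hf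
  have hbound : ∀ (i : ℕ), ∀ r ∈ Set.Icc (0 : ℝ) 1, ‖f i r‖ ≤ |Ring.choose a i| := by
    intro i r hr
    have h1 : ‖(r : ℂ) * z‖ ≤ 1 := by
      rw [norm_mul, Complex.norm_real, norm_eq_abs, abs_of_nonneg hr.1]
      exact mul_le_one₀ hr.2 (norm_nonneg _) hz
    rw [hf, norm_mul, Complex.norm_real, norm_eq_abs, abs_mul, abs_pow, abs_neg, abs_one, one_pow,
      one_mul, norm_pow]
    exact mul_le_of_le_one_right (abs_nonneg _) (pow_le_one₀ (norm_nonneg _) h1)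
  have hsum := summable_ring_choose ha0.le ha1
  have hcont : ContinuousOn (fun r ↦ ∑' i, f i r) (Set.Icc 0 1) :=
    continuousOn_tsum (fun i ↦ by rw [hf]; fun_prop) hsum hbound
  have hinner : ∀ r ∈ Set.Ico (0 : ℝ) 1, ∑' i, f i r = (1 - r * z) ^ (a : ℂ) := by
    intro r hr
    have h1 : ‖-((r : ℂ) * z)‖ < 1 := by
      rw [norm_neg, norm_mul, Complex.norm_real, norm_eq_abs, abs_of_nonneg hr.1]
      exact (mul_le_of_le_one_right hr.1 hz).trans_lt hr.2
    have h := (Complex.one_add_cpow_hasFPowerSeriesOnBall_zero (a := (a : ℂ))).hasSum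
      (y := -((r : ℂ) * z)) (by rw [← ENNReal.ofReal_one, Metric.eball_ofReal]; simpa using h1)
    rw [zero_add, ← sub_eq_add_neg] at h
    rw [← h.tsum_eq]
    refine tsum_congr fun i ↦ ?_
    simp [hf, neg_pow ((r : ℂ) * z), Complex.ofReal_choose, binomialSeries]
    ring
  have hre : 0 ≤ (1 - z).re := by
    have := (Complex.re_le_norm z).trans hz
    simpa using this
  have hlim : Filter.Tendsto (fun r : ℝ ↦ (1 - (r : ℂ) * z) ^ (a : ℂ)) (nhdsWithin 1 (Set.Ico 0 1))
      (nhds ((1 - z) ^ (a : ℂ))) := by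
    have h := (Complex.continuousAt_cpow_const_of_re_pos (z := 1 - z) (w := a) (Or.inl hre)
      (by simpa using ha0)).tendsto
    refine h.comp (Filter.Tendsto.mono_left ?_ nhdsWithin_le_nhds)
    have hc : Continuous fun r : ℝ ↦ 1 - (r : ℂ) * z := by fun_prop
    simpa using hc.tendsto 1
  have hlim' := (hcont 1 (by simp)).mono_left (nhdsWithin_mono 1 Set.Ico_subset_Icc_self)
  have hne : (nhdsWithin (1 : ℝ) (Set.Ico 0 1)).NeBot := by
    rw [← mem_closure_iff_nhdsWithin_neBot, closure_Ico zero_ne_one]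
    simp
  have heq := tendsto_nhds_unique
    (hlim'.congr' (eventually_nhdsWithin_of_forall hinner)) hlim
  rw [← heq]
  have hs : Summable fun i ↦ f i 1 :=
    Summable.of_norm_bounded hsum fun i ↦ hbound i 1 (by simp)
  simpa [hf] using hs.hasSum

theorem one_sub_exp_cpow_re {a β : ℝ} (ha : a ≠ 0) (h1 : -(π / 2) ≤ β)
    (h2 : β ≤ π / 2) (φ : ℝ) :
    (Complex.exp (φ * Complex.I) *
      (1 - Complex.exp ((π - 2 * β : ℝ) * Complex.I)) ^ (a : ℂ)).re =
      (2 * cos β) ^ a * cos (φ - β * a) := by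
  have hpi := pi_pos
  have hcos : 0 ≤ 2 * cos β := by
    have := cos_nonneg_of_neg_pi_div_two_le_of_le h1 h2
    linarith
  have hw : 1 - Complex.exp ((π - 2 * β : ℝ) * Complex.I) =
      ((2 * cos β : ℝ) : ℂ) * (Complex.cos (-β : ℝ) + Complex.sin (-β : ℝ) * Complex.I) := by
    rw [Complex.exp_mul_I, ← Complex.ofReal_cos, ← Complex.ofReal_sin, ← Complex.ofReal_cos,
      ← Complex.ofReal_sin, cos_pi_sub, sin_pi_sub, cos_two_mul, sin_two_mul, cos_neg, sin_neg]
    push_cast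
    ring
  rw [hw]
  rcases hcos.eq_or_lt with h0 | hpos
  · rw [← h0, zero_rpow ha]
    simp [ha]
  · rw [Complex.cpow_ofReal, Complex.arg_mul_cos_add_sin_mul_I hpos ⟨by linarith, by linarith⟩,
      norm_mul, Complex.norm_cos_add_sin_mul_I, Complex.norm_real, norm_eq_abs,
      abs_of_nonneg hcos, mul_one, Complex.exp_mul_I, ← Complex.ofReal_cos, ← Complex.ofReal_sin,
      sub_eq_add_neg φ, cos_add, neg_mul, cos_neg,
      sin_neg]
    simp [-Complex.ofReal_cos, -Complex.ofReal_sin]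
    ring

/-- Fourier series of the boundary values of `(1 - z) ^ a`, with the frequencies shifted by `q`. -/
theorem hasSum_ring_choose_mul_cos {a β : ℝ} (ha0 : 0 < a) (ha1 : a ≤ 1) (h1 : -(π / 2) ≤ β)
    (h2 : β ≤ π / 2) (q : ℝ) :
    HasSum (fun i : ℕ ↦ (-1 : ℝ) ^ i * Ring.choose a i * cos ((i - q) * (π - 2 * β)))
      ((2 * cos β) ^ a * cos (q * (π - 2 * β) + β * a)) := by
  have h := Complex.hasSum_re ((hasSum_one_sub_cpow ha0 ha1
    (Complex.norm_exp_ofReal_mul_I (π - 2 * β)).le).mul_left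
      (Complex.exp ((-(q * (π - 2 * β)) : ℝ) * Complex.I)))
  rw [one_sub_exp_cpow_re ha0.ne' h1 h2, ← neg_add', cos_neg] at h
  refine h.congr_fun fun i ↦ ?_
  rw [← Complex.exp_nat_mul, mul_left_comm, ← Complex.exp_add, Complex.re_ofReal_mul,
    ← mul_assoc (i : ℂ), ← add_mul, ← Complex.ofReal_natCast, ← Complex.ofReal_mul,
    ← Complex.ofReal_add, Complex.exp_ofReal_mul_I_re]
  ring_nf

theorem sin_half_mul_dirichlet_kernel (x : ℝ) (n : ℕ) :
    sin (x / 2) * (1 + 2 * ∑ j ∈ range n, cos ((j + 1) * x)) = sin ((2 * n + 1) * (x / 2)) := by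
  induction n with
  | zero => simp
  | succ n ih =>
    rw [sum_range_succ, mul_add 2, ← add_assoc, mul_add, ih]
    have h1 : (2 * ((n + 1 : ℕ) : ℝ) + 1) * (x / 2) = (n + 1) * x + x / 2 := by push_cast; ring
    have h2 : (2 * (n : ℝ) + 1) * (x / 2) = (n + 1) * x - x / 2 := by ring
    rw [h1, h2, sin_add, sin_sub]
    ring

theorem dirichlet_kernel_two_pi_mul_div (n : ℕ) (m : ℤ) :
    1 + 2 * ∑ j ∈ range n, cos (m * (2 * π * (j + 1) / (2 * n + 1))) =
      if (2 * (n : ℤ) + 1) ∣ m then 2 * (n : ℝ) + 1 else 0 := by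
  have hl : (2 * (n : ℝ) + 1) ≠ 0 := by positivity
  split_ifs with h
  · obtain ⟨t, rfl⟩ := h
    have hone : ∀ j ∈ range n, cos (((2 * (n : ℤ) + 1) * t : ℤ) *
        (2 * π * (j + 1) / (2 * n + 1))) = 1 := by
      intro j _
      convert cos_int_mul_two_pi (t * (j + 1)) using 2
      push_cast
      field_simp
    rw [sum_congr rfl hone]
    simp
    ring
  · have hk := sin_half_mul_dirichlet_kernel (2 * π * m / (2 * n + 1)) n
    have hz : (2 * (n : ℝ) + 1) * (2 * π * m / (2 * n + 1) / 2) = m * π := by field_simp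
    rw [hz, sin_int_mul_pi] at hk
    rcases mul_eq_zero.1 hk with h0 | h0
    · obtain ⟨t, ht⟩ := sin_eq_zero_iff.1 h0
      refine absurd ⟨t, ?_⟩ h
      have hpi := pi_ne_zero
      field_simp at ht
      have : (m : ℝ) = (2 * n + 1) * t := by linarith
      exact_mod_cast this
    · rw [← h0]
      congr! 4
      field_simp

theorem one_add_two_mul_sum_cos_odd_multiples (n : ℕ) (m : ℤ) :
    1 + 2 * ∑ j ∈ range n, cos (m * (π - 2 * (π * (2 * j + 1) / (2 * (2 * (n : ℝ) + 1))))) =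
      if (2 * (n : ℤ) + 1) ∣ m then 2 * (n : ℝ) + 1 else 0 := by
  rw [← dirichlet_kernel_two_pi_mul_div, ← sum_range_reflect _ n]
  congr 2
  refine sum_congr rfl fun j hj ↦ ?_
  have hj : j + 1 ≤ n := mem_range.1 hj
  rw [Nat.sub_sub, Nat.cast_sub (by lia)]
  congr 2
  push_cast
  field_simp
  ring

theorem Gamma_natCast_add_div_Gamma {α : ℝ} (hα : 0 < α) (m : ℕ) :
    Gamma (m + α) / Gamma (m + 1) = Gamma α * ((-1) ^ m * Ring.choose (-α) m) := by
  induction m with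
  | zero => simp
  | succ m ih =>
    have hm : (0 : ℝ) < m + 1 := by positivity
    have hg : Gamma ((m : ℝ) + 1) ≠ 0 := (Gamma_pos_of_pos hm).ne'
    have h1 : ((m + 1 : ℕ) : ℝ) + α = (m + α) + 1 := by push_cast; ring
    have h := ring_choose_succ_mul (-α) m
    rw [h1, Gamma_add_one (by positivity), Nat.cast_succ, Gamma_add_one hm.ne']
    have h2 : (m + α) * Gamma (m + α) / ((m + 1) * Gamma (m + 1)) =
      (m + α) / (m + 1) * (Gamma (m + α) / Gamma (m + 1)) := by field_simp
    rw [h2, ih, eq_div_of_mul_eq hm.ne' h]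
    ring

/-- The decrements of the falling-factorial kernel are binomial coefficients. -/
theorem falling_factorial_kernel_sub {α : ℝ} (hα : 0 < α) {U : ℤ → ℝ}
    (hU1 : ∀ m : ℤ, 1 ≤ m → U m = Gamma ((m : ℝ) + α - 1) / Gamma (m : ℝ))
    (hU0 : ∀ m : ℤ, m ≤ 0 → U m = 0) (i : ℕ) :
    U i - U (i + 1) = -Gamma α * ((-1) ^ i * Ring.choose (1 - α) i) := by
  have hU (m : ℕ) : U (m + 1) = Gamma α * ((-1) ^ m * Ring.choose (-α) m) := by
    rw [← Gamma_natCast_add_div_Gamma hα, hU1 _ (by lia)]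
    push_cast
    congr 2
    ring
  cases i with
  | zero =>
    have h := hU 0
    simp only [Nat.cast_zero] at h ⊢
    rw [h, hU0 0 le_rfl]
    simp
  | succ i =>
    rw [hU, Nat.cast_succ, hU]
    have hs := Ring.choose_succ_succ (-α) i
    rw [neg_add_eq_sub] at hs
    rw [hs]
    ring

/-- The multisection of the binomial coefficients of `(1 - z) ^ a` along residues modulo
`2 * n + 1`. -/
theorem hasSum_ring_choose_residue {a : ℝ} (ha0 : 0 < a) (ha1 : a ≤ 1) {n q : ℕ}
    (hq : q < 2 * n + 1) :
    HasSum (fun k : ℕ ↦ (-1 : ℝ) ^ ((2 * n + 1) * k + q) * Ring.choose a ((2 * n + 1) * k + q))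
      (2 / (2 * n + 1) * ∑ j ∈ range n,
        (2 * cos (π * (2 * j + 1) / (2 * (2 * (n : ℝ) + 1)))) ^ a *
          cos (q * (π - 2 * (π * (2 * j + 1) / (2 * (2 * (n : ℝ) + 1)))) +
            π * (2 * j + 1) / (2 * (2 * (n : ℝ) + 1)) * a)) := by
  have hl : (2 * (n : ℝ) + 1) ≠ 0 := by positivity
  set β : ℕ → ℝ := fun j ↦ π * (2 * j + 1) / (2 * (2 * (n : ℝ) + 1)) with hβ
  have hβ0 (j : ℕ) : -(π / 2) ≤ β j := by
    have : 0 ≤ β j := by positivity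
    linarith [pi_pos]
  have hβ1 : ∀ j ∈ range n, β j ≤ π / 2 := by
    intro j hj
    have hj : (j : ℝ) + 1 ≤ n := by exact_mod_cast mem_range.1 hj
    rw [hβ, div_le_div_iff₀ (by positivity) two_pos]
    nlinarith [pi_pos]
  have hz := hasSum_ring_choose_mul_cos ha0 ha1 (by linarith [pi_pos]) le_rfl (q : ℝ)
  have hs := hasSum_sum fun j hj ↦ hasSum_ring_choose_mul_cos ha0 ha1 (hβ0 j) (hβ1 j hj) (q : ℝ)
  have h := (hz.add (hs.mul_left 2)).mul_left (1 / (2 * (n : ℝ) + 1))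
  rw [cos_pi_div_two, mul_zero, zero_rpow ha0.ne', zero_mul, zero_add, ← mul_assoc,
    one_div_mul_eq_div] at h
  have hinj : Function.Injective fun k : ℕ ↦ (2 * n + 1) * k + q := by
    intro k k' hk
    simpa using hk
  have hterm (i : ℕ) : 1 / (2 * (n : ℝ) + 1) *
      ((-1 : ℝ) ^ i * Ring.choose a i * cos ((i - q) * (π - 2 * (π / 2))) +
        2 * ∑ j ∈ range n, (-1 : ℝ) ^ i * Ring.choose a i * cos ((i - q) * (π - 2 * β j))) =
      if (2 * (n : ℤ) + 1) ∣ (i : ℤ) - q then (-1 : ℝ) ^ i * Ring.choose a i else 0 := by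
    have hd := one_add_two_mul_sum_cos_odd_multiples n ((i : ℤ) - q)
    push_cast at hd
    rw [← mul_sum, mul_div_cancel₀ π two_ne_zero, sub_self, mul_zero, cos_zero, mul_left_comm 2,
      ← mul_add, hd]
    split_ifs <;> field_simp; simp
  simp only [hterm] at h
  refine ((hinj.hasSum_iff fun i hi ↦ if_neg fun hdvd ↦ hi ?_).2 h).congr_fun fun k ↦ ?_
  · obtain ⟨t, ht⟩ := hdvd
    have ht0 : 0 ≤ t := by
      by_contra! hneg
      have : (2 * (n : ℤ) + 1) * t ≤ (2 * (n : ℤ) + 1) * (-1) :=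
        mul_le_mul_of_nonneg_left (by lia) (by positivity)
      lia
    lift t to ℕ using ht0
    refine ⟨t, ?_⟩
    zify
    lia
  · rw [Function.comp_apply, if_pos ⟨(k : ℤ), by push_cast; ring⟩]

/-- Closed-form evaluation of the sums `S_{p,2n+1}` for the falling-factorial kernel
`U_α(m) = Γ(m+α−1)/Γ(m)` (`m ≥ 1`), `U_α(m) = 0` (`m ≤ 0`), of order `0 < α < 1`:
for `n ≥ 0` and `1 ≤ p ≤ 2n+1`,
`S_{p,2n+1} = Σ_{k=0}^∞ [U_α((2n+1)k+p−1) − U_α((2n+1)k+p)]` converges and equals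
`(2^{2−α}Γ(α)/(2n+1))·(−1)^p · Σ_{j=0}^{n−1} (cos(π(2j+1)/(2(2n+1))))^{1−α} · (−1)^j ·
sin(π(2j+1)(2p+2n−2+α)/(2(2n+1)))`. -/
theorem S_p_odd_closed_form
    (α : ℝ) (hα0 : 0 < α) (hα1 : α < 1)
    (U : ℤ → ℝ)
    (hU1 : ∀ m : ℤ, 1 ≤ m → U m = Real.Gamma ((m : ℝ) + α - 1) / Real.Gamma (m : ℝ))
    (hU0 : ∀ m : ℤ, m ≤ 0 → U m = 0)
    (n : ℕ) (p : ℕ) (hp1 : 1 ≤ p) (hp2 : p ≤ 2 * n + 1) :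
    HasSum (fun k : ℕ =>
        U ((2 * (n : ℤ) + 1) * k + p - 1) - U ((2 * (n : ℤ) + 1) * k + p))
      (((2 : ℝ) ^ (2 - α) * Real.Gamma α / (2 * (n : ℝ) + 1)) * (-1 : ℝ) ^ p *
        ∑ j ∈ range n,
          (Real.cos (π * (2 * j + 1) / (2 * (2 * (n : ℝ) + 1)))) ^ (1 - α) * (-1 : ℝ) ^ j *
            Real.sin (π * (2 * j + 1) * (2 * p + 2 * n - 2 + α) / (2 * (2 * (n : ℝ) + 1)))) := by
  obtain ⟨q, rfl⟩ : ∃ q, p = q + 1 := ⟨p - 1, by lia⟩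
  have h := (hasSum_ring_choose_residue (sub_pos.2 hα1) (by linarith) (n := n)
    (q := q) (by lia)).mul_left (-Gamma α)
  refine Eq.subst (motive := HasSum _) ?_ (h.congr_fun fun k ↦ ?_)
  rotate_left
  · rw [← falling_factorial_kernel_sub hα0 hU1 hU0]
    push_cast
    ring_nf
  · rw [← mul_assoc, mul_sum, mul_sum, eq_comm]
    refine sum_congr rfl fun j hj ↦ ?_
    have hj : (j : ℝ) + 1 ≤ n := by exact_mod_cast mem_range.1 hj
    have hl : (2 * (n : ℝ) + 1) ≠ 0 := by positivity
    set β : ℝ := π * (2 * j + 1) / (2 * (2 * (n : ℝ) + 1)) with hβ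
    have hcos : 0 ≤ cos β := by
      refine cos_nonneg_of_neg_pi_div_two_le_of_le ?_ ?_
      · have : 0 ≤ β := by positivity
        linarith [pi_pos]
      · rw [hβ, div_le_div_iff₀ (by positivity) two_pos]
        nlinarith [pi_pos]
    have hsin : π * (2 * j + 1) * (2 * ((q + 1 : ℕ) : ℝ) + 2 * n - 2 + α) /
        (2 * (2 * (n : ℝ) + 1)) = (2 * q - 1 + α) * β + π / 2 + j * π := by
      rw [hβ]
      push_cast
      field_simp
      ring
    have hφ : q * (π - 2 * β) + β * (1 - α) = q * π - (2 * q - 1 + α) * β := by ring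
    have hpow : (2 : ℝ) ^ (2 - α) = 2 * 2 ^ (1 - α) := by
      rw [← rpow_one_add' two_pos.le (by linarith)]
      ring_nf
    have hsign : ((-1 : ℝ) ^ j) * (-1) ^ j = 1 := by rw [← mul_pow]; simp
    rw [hsin, sin_add_nat_mul_pi, sin_add_pi_div_two, hφ, cos_nat_mul_pi_sub,
      mul_rpow two_pos.le hcos, hpow, pow_succ]
    linear_combination (-(2 * 2 ^ (1 - α) * Gamma α / (2 * (n : ℝ) + 1)) * (-1) ^ q *
      cos β ^ (1 - α) * cos ((2 * q - 1 + α) * β)) * hsign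
end

section
/- Let m ≥ 1 be an integer, let m−1 < α < m, and let U_α(n) = Γ(n+α−1)/Γ(n) for integers n ≥ 1 and U_α(n) = 0 for n ≤ 0 be the falling-factorial kernel of order α. Define U_α^{j}(n) recursively by U_α^{0}(n) = U_α(n) and U_α^{j}(n) = U_α^{j−1}(n) − U_α^{j−1}(n−1). Then for every integer l ≥ 1 and every j with 0 ≤ j < l, the sum S^{m−1}_{j+1,l}(α) := Σ_{k=0}^{∞} [U_α^{m−1}(lk+j) − U_α^{m−1}(lk+j+1)] converges and satisfies S^{m−1}_{j+1,l}(α) = (α−1)^{(m−1)} · S_{j+1,l}(α−m+1), where S_{j+1,l}(β) := Σ_{k=0}^{∞} [U_β(lk+j) − U_β(lk+j+1)] and (α−1)^{(m−1)} = Γ(α)/Γ(α−m+1). -/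
/-- The difference of the ratio `Γ(x+a) / Γ(x)` over the step from `x` to `x + 1`. -/
theorem gamma_ratio_backward_difference {x a : ℝ} (hx : 0 < x) (hxa : 0 < x + a) :
    Real.Gamma (x + 1 + a) / Real.Gamma (x + 1) - Real.Gamma (x + a) / Real.Gamma x
      = a * (Real.Gamma (x + a) / Real.Gamma (x + 1)) := by
  have hG : Real.Gamma x ≠ 0 := (Real.Gamma_pos_of_pos hx).ne'
  rw [show x + 1 + a = (x + a) + 1 by ring, Real.Gamma_add_one hxa.ne', Real.Gamma_add_one hx.ne']
  field_simp
  ring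

/-- Closed form of the iterated backward differences of the falling-factorial kernel. -/
theorem iterated_backward_difference_eq {α : ℝ} {U : ℤ → ℝ} {V : ℕ → ℤ → ℝ}
    (hU1 : ∀ n : ℤ, 1 ≤ n → U n = Real.Gamma ((n : ℝ) + α - 1) / Real.Gamma (n : ℝ))
    (hU0 : ∀ n : ℤ, n ≤ 0 → U n = 0)
    (hV0 : ∀ n : ℤ, V 0 n = U n)
    (hVs : ∀ (j : ℕ) (n : ℤ), V (j + 1) n = V j n - V j (n - 1))
    (i : ℕ) (hi : (i : ℝ) < α) :
    (∀ n : ℤ, n ≤ 0 → V i n = 0) ∧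
      ∀ n : ℤ, 1 ≤ n → V i n = Real.Gamma α / Real.Gamma (α - i) *
        (Real.Gamma ((n : ℝ) + (α - i) - 1) / Real.Gamma (n : ℝ)) := by
  induction i with
  | zero =>
    refine ⟨fun n hn => by rw [hV0, hU0 n hn], fun n hn => ?_⟩
    have hα : Real.Gamma α ≠ 0 := (Real.Gamma_pos_of_pos (by simpa using hi)).ne'
    simp [hV0, hU1 n hn, hα]
  | succ i ih =>
    push_cast at hi
    obtain ⟨ih0, ih1⟩ := ih (by linarith)
    refine ⟨fun n hn => by rw [hVs, ih0 n hn, ih0 (n - 1) (by lia), sub_zero], fun n hn => ?_⟩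
    have ha : 0 < α - (i + 1) := by linarith
    have hG := (Real.Gamma_pos_of_pos ha).ne'
    have hstep : Real.Gamma (α - i) = (α - (i + 1)) * Real.Gamma (α - (i + 1)) := by
      rw [← Real.Gamma_add_one ha.ne']
      ring_nf
    push_cast
    rw [hVs, ih1 n hn]
    rcases hn.eq_or_lt with rfl | hn'
    · have hG' : Real.Gamma (α - i) ≠ 0 := (Real.Gamma_pos_of_pos (by linarith)).ne'
      rw [ih0 (1 - 1) (by lia)]
      simp [hG, hG']
    · have hn1 : (0 : ℝ) < (n : ℝ) - 1 := by
        have : (1 : ℝ) < n := by exact_mod_cast hn'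
        linarith
      have key := gamma_ratio_backward_difference hn1 (add_pos hn1 ha)
      rw [show (n : ℝ) - 1 + 1 + (α - (i + 1)) = n + (α - i) - 1 by ring,
        show (n : ℝ) - 1 + 1 = n by ring,
        show (n : ℝ) - 1 + (α - (i + 1)) = n + (α - (i + 1)) - 1 by ring] at key
      rw [ih1 (n - 1) (by lia)]
      push_cast
      rw [show (n : ℝ) - 1 + (α - i) - 1 = n + (α - (i + 1)) - 1 by ring, ← mul_sub, key, hstep]
      field_simp

/-- The sums `∑ (f(lk+j) - f(lk+j+1))` converge when `f` is nonnegative and antitone on the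
positive integers. -/
theorem summable_sub_of_antitoneOn {f : ℤ → ℝ} (hf0 : ∀ n : ℤ, 1 ≤ n → 0 ≤ f n)
    (hf : AntitoneOn f (Set.Ici 1)) {l : ℕ} (hl : 1 ≤ l) (j : ℕ) :
    Summable fun k : ℕ => f ((l : ℤ) * k + j) - f ((l : ℤ) * k + j + 1) := by
  have hpos (k : ℕ) : (1 : ℤ) ≤ (l : ℤ) * ((k + 1 : ℕ) : ℤ) + j := by
    have : 1 ≤ l * (k + 1) := Nat.mul_pos hl k.succ_pos
    exact_mod_cast this.trans (Nat.le_add_right _ j)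
  have hanti {a b : ℤ} (ha : 1 ≤ a) (hab : a ≤ b) : f b ≤ f a :=
    hf (Set.mem_Ici.2 ha) (Set.mem_Ici.2 (ha.trans hab)) hab
  rw [← summable_nat_add_iff 1]
  refine summable_of_sum_range_le (c := f ((l : ℤ) * ((0 + 1 : ℕ) : ℤ) + j))
    (fun k => sub_nonneg.2 (hanti (hpos k) (by lia))) fun N => ?_
  calc _ ≤ ∑ k ∈ Finset.range N, (f ((l : ℤ) * ((k + 1 : ℕ) : ℤ) + j)
          - f ((l : ℤ) * ((k + 1 + 1 : ℕ) : ℤ) + j)) := by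
        refine Finset.sum_le_sum fun k _ => sub_le_sub_left (hanti ?_ ?_) _
        · linarith [hpos k]
        · push_cast
          have : (1 : ℤ) ≤ l := by exact_mod_cast hl
          linarith
    _ = f ((l : ℤ) * ((0 + 1 : ℕ) : ℤ) + j) - f ((l : ℤ) * ((N + 1 : ℕ) : ℤ) + j) :=
        Finset.sum_range_sub' (fun k : ℕ => f ((l : ℤ) * ((k + 1 : ℕ) : ℤ) + j)) N
    _ ≤ _ := sub_le_self _ (hf0 _ (hpos N))

/-- The falling-factorial kernel of order `β ≤ 1` is antitone on the positive integers. -/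
theorem antitoneOn_kernel {β : ℝ} (hβ0 : 0 < β) (hβ1 : β ≤ 1) {W : ℤ → ℝ}
    (hW : ∀ n : ℤ, 1 ≤ n → W n = Real.Gamma ((n : ℝ) + β - 1) / Real.Gamma (n : ℝ)) :
    AntitoneOn W (Set.Ici 1) := by
  refine antitoneOn_of_succ_le Set.ordConnected_Ici fun n _ hn _ => ?_
  have hn1 : (1 : ℝ) ≤ n := by exact_mod_cast Set.mem_Ici.1 hn
  rw [Order.succ_eq_add_one, hW n hn, hW (n + 1) (by have := Set.mem_Ici.1 hn; lia), ← sub_nonpos]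
  have key := gamma_ratio_backward_difference (x := n) (a := β - 1) (by linarith) (by linarith)
  push_cast
  rw [show (n : ℝ) + 1 + β - 1 = n + 1 + (β - 1) by ring, add_sub_assoc (n : ℝ), key]
  refine mul_nonpos_of_nonpos_of_nonneg (by linarith) (div_nonneg ?_ ?_)
  · exact (Real.Gamma_pos_of_pos (by linarith)).le
  · exact (Real.Gamma_pos_of_pos (by linarith)).le

/-- Reduction of the order-`α` sums `S^{m−1}_{j+1,l}(α)` for the falling-factorial kernel to
the order-`(α−m+1)` sums: with `U_α(n) = Γ(n+α−1)/Γ(n)` (`n ≥ 1`), `U_α(n) = 0` (`n ≤ 0`),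
`V j` its `j`-th iterated backward difference, and `W` the falling-factorial kernel of order
`α−m+1`, for every `l ≥ 1` and `0 ≤ j < l` the sums
`S^{m−1}_{j+1,l}(α) = Σ_{k=0}^∞ [V_{m−1}(lk+j) − V_{m−1}(lk+j+1)]` and
`S_{j+1,l}(α−m+1) = Σ_{k=0}^∞ [W(lk+j) − W(lk+j+1)]` converge, and
`S^{m−1}_{j+1,l}(α) = (α−1)^{(m−1)} · S_{j+1,l}(α−m+1)`
where `(α−1)^{(m−1)} = Γ(α)/Γ(α−m+1)`. -/
theorem S_sums_order_reduction
    (m : ℕ) (hm : 1 ≤ m) (α : ℝ) (hα1 : (m : ℝ) - 1 < α) (hα2 : α < m)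
    (U : ℤ → ℝ)
    (hU1 : ∀ n : ℤ, 1 ≤ n → U n = Real.Gamma ((n : ℝ) + α - 1) / Real.Gamma (n : ℝ))
    (hU0 : ∀ n : ℤ, n ≤ 0 → U n = 0)
    (V : ℕ → ℤ → ℝ)
    (hV0 : ∀ n : ℤ, V 0 n = U n)
    (hVs : ∀ (j : ℕ) (n : ℤ), V (j + 1) n = V j n - V j (n - 1))
    (W : ℤ → ℝ)
    (hW1 : ∀ n : ℤ, 1 ≤ n → W n = Real.Gamma ((n : ℝ) + (α - m + 1) - 1) / Real.Gamma (n : ℝ))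
    (hW0 : ∀ n : ℤ, n ≤ 0 → W n = 0)
    (l : ℕ) (hl : 1 ≤ l) (j : ℕ) (hj : j < l) :
    ∃ S : ℝ,
      HasSum (fun k : ℕ => W ((l : ℤ) * k + j) - W ((l : ℤ) * k + j + 1)) S ∧
      HasSum (fun k : ℕ => V (m - 1) ((l : ℤ) * k + j) - V (m - 1) ((l : ℤ) * k + j + 1))
        ((Real.Gamma α / Real.Gamma (α - m + 1)) * S) := by
  have hcast : ((m - 1 : ℕ) : ℝ) = m - 1 := by simp [Nat.cast_sub hm]
  obtain ⟨hV_nonpos, hV_pos⟩ :=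
    iterated_backward_difference_eq hU1 hU0 hV0 hVs (m - 1) (by rwa [hcast])
  have horder : α - ((m - 1 : ℕ) : ℝ) = α - m + 1 := by rw [hcast]; ring
  have hVW (n : ℤ) : V (m - 1) n = Real.Gamma α / Real.Gamma (α - m + 1) * W n := by
    rcases le_or_gt n 0 with hn | hn
    · rw [hV_nonpos n hn, hW0 n hn, mul_zero]
    · rw [hV_pos n hn, hW1 n hn, horder]
  have hW_nonneg (n : ℤ) (hn : 1 ≤ n) : 0 ≤ W n := by
    have hn1 : (1 : ℝ) ≤ n := by exact_mod_cast hn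
    rw [hW1 n hn]
    exact div_nonneg (Real.Gamma_pos_of_pos (by linarith)).le
      (Real.Gamma_pos_of_pos (by linarith)).le
  have hsum := summable_sub_of_antitoneOn hW_nonneg
    (antitoneOn_kernel (by linarith) (by linarith) hW1) hl j
  refine ⟨_, hsum.hasSum, ?_⟩
  simp only [hVW, ← mul_sub]
  exact hsum.hasSum.mul_left _
end

section
/- Let m ≥ 1 be an integer, let α be a real number with m−1 < α ≤ m, and let U_α(n) = Γ(n+α−1)/Γ(n) for integers n ≥ 1 and U_α(n) = 0 for n ≤ 0. Define U_α^{j}(n) recursively by U_α^{0}(n) = U_α(n) and U_α^{j}(n) = U_α^{j−1}(n) − U_α^{j−1}(n−1). Then for every integer n ≥ 1, U_α^{m−1}(n) = Γ(α)·Γ(n+α−m)/(Γ(α−m+1)·Γ(n)). -/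
/-- Pascal-type rule for the ratio `Γ(x+a)/(Γ(a+1)Γ(x))` under the backward difference. -/
theorem Real.Gamma_ratio_sub {a x : ℝ} (ha : 0 < a) (hx : 1 < x) :
    Real.Gamma (x + a) / (Real.Gamma (a + 1) * Real.Gamma x) -
        Real.Gamma (x - 1 + a) / (Real.Gamma (a + 1) * Real.Gamma (x - 1)) =
      Real.Gamma (x - 1 + a) / (Real.Gamma a * Real.Gamma x) := by
  have h1 : Real.Gamma (x + a) = (x - 1 + a) * Real.Gamma (x - 1 + a) := by
    rw [← Real.Gamma_add_one (by linarith)]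
    ring_nf
  have h2 : Real.Gamma x = (x - 1) * Real.Gamma (x - 1) := by
    rw [← Real.Gamma_add_one (by linarith)]
    ring_nf
  have h3 : Real.Gamma (x - 1) ≠ 0 := (Real.Gamma_pos_of_pos (by linarith)).ne'
  have h4 : Real.Gamma a ≠ 0 := (Real.Gamma_pos_of_pos ha).ne'
  have h5 : x - 1 ≠ 0 := by linarith
  rw [h1, h2, Real.Gamma_add_one ha.ne']
  field_simp
  ring

/-- The `j`-th iterated backward difference of the falling-factorial kernel, for `j < α`. -/
theorem iterated_difference_kernel_of_lt (α : ℝ) (U : ℤ → ℝ)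
    (hU1 : ∀ n : ℤ, 1 ≤ n → U n = Real.Gamma ((n : ℝ) + α - 1) / Real.Gamma (n : ℝ))
    (hU0 : ∀ n : ℤ, n ≤ 0 → U n = 0)
    (V : ℕ → ℤ → ℝ)
    (hV0 : ∀ n : ℤ, V 0 n = U n)
    (hVs : ∀ (j : ℕ) (n : ℤ), V (j + 1) n = V j n - V j (n - 1))
    (j : ℕ) (hj : (j : ℝ) < α) :
    (∀ n : ℤ, n ≤ 0 → V j n = 0) ∧
      ∀ n : ℤ, 1 ≤ n → V j n = Real.Gamma α *
        (Real.Gamma ((n : ℝ) - 1 + (α - j)) / (Real.Gamma (α - j) * Real.Gamma (n : ℝ))) := by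
  induction j with
  | zero =>
    refine ⟨fun n hn => by rw [hV0, hU0 n hn], fun n hn => ?_⟩
    have hα : Real.Gamma α ≠ 0 := (Real.Gamma_pos_of_pos (by simpa using hj)).ne'
    rw [hV0, hU1 n hn, Nat.cast_zero, sub_zero, ← add_sub_right_comm, ← mul_div_assoc,
      mul_div_mul_left _ _ hα]
  | succ j ih =>
    push_cast at hj ⊢
    obtain ⟨ih0, ih1⟩ := ih (by linarith)
    refine ⟨fun n hn => by rw [hVs, ih0 n hn, ih0 (n - 1) (by omega), sub_zero], fun n hn => ?_⟩
    obtain ⟨a, rfl⟩ : ∃ a : ℝ, α = a + (j + 1) := ⟨α - (j + 1), by ring⟩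
    have ha : 0 < a := by linarith
    have e1 : a + (j + 1) - (j : ℝ) = a + 1 := by ring
    have e2 : ∀ x : ℝ, x - 1 + (a + 1) = x + a := fun x => by ring
    simp only [e1, e2] at ih1
    rw [hVs, ih1 n hn, add_sub_cancel_right]
    rcases hn.eq_or_lt with rfl | hn'
    · have h1 : Real.Gamma (a + 1) ≠ 0 := (Real.Gamma_pos_of_pos (by linarith)).ne'
      have h2 : Real.Gamma a ≠ 0 := (Real.Gamma_pos_of_pos ha).ne'
      rw [ih0 (1 - 1) (by norm_num)]
      simp [add_comm 1 a, h1, h2]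
    · rw [ih1 (n - 1) (by omega), ← mul_sub]
      push_cast
      rw [Real.Gamma_ratio_sub ha (by exact_mod_cast hn')]


/-- Closed form of the `(m−1)`-st iterated backward difference of the falling-factorial
kernel: with `m−1 < α ≤ m`, `U_α(n) = Γ(n+α−1)/Γ(n)` (`n ≥ 1`), `U_α(n) = 0` (`n ≤ 0`),
and `V j` its `j`-th iterated backward difference, for every `n ≥ 1`
`U_α^{m−1}(n) = Γ(α)·Γ(n+α−m)/(Γ(α−m+1)·Γ(n))`. -/
theorem iterated_difference_falling_factorial_kernel
    (m : ℕ) (hm : 1 ≤ m) (α : ℝ) (hα1 : (m : ℝ) - 1 < α) (hα2 : α ≤ m)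
    (U : ℤ → ℝ)
    (hU1 : ∀ n : ℤ, 1 ≤ n → U n = Real.Gamma ((n : ℝ) + α - 1) / Real.Gamma (n : ℝ))
    (hU0 : ∀ n : ℤ, n ≤ 0 → U n = 0)
    (V : ℕ → ℤ → ℝ)
    (hV0 : ∀ n : ℤ, V 0 n = U n)
    (hVs : ∀ (j : ℕ) (n : ℤ), V (j + 1) n = V j n - V j (n - 1)) :
    ∀ n : ℤ, 1 ≤ n →
      V (m - 1) n = Real.Gamma α * Real.Gamma ((n : ℝ) + α - m) /
        (Real.Gamma (α - m + 1) * Real.Gamma (n : ℝ)) := by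
  intro n hn
  have hc : ((m - 1 : ℕ) : ℝ) = m - 1 := by push_cast [hm]; rfl
  have h := (iterated_difference_kernel_of_lt α U hU1 hU0 V hV0 hVs (m - 1) (by rwa [hc])).2 n hn
  rw [h, hc, mul_div_assoc]
  ring_nf
end

section
/- Let 0 < α < 1, h > 0, S₂₂ > 0, K ∈ ℝ with K ≠ 0, and set K_C = Γ(α)/(h^α S₂₂) and G⁰(x) = (h^α/Γ(α))·(x − Kx(1−x)). Consider the asymptotic period-2 system: G⁰(x₁) + G⁰(x₂) = 0 and x₂ − x₁ = −S₂₂·G⁰(x₁) + S₂₂·G⁰(x₂). If (K−1)² ≥ K_C², then the pair x_{1,2} = (K_C + K − 1 ± √((K−1)² − K_C²))/(2K) satisfies this system; conversely, every real solution (x₁, x₂) of the system with x₁ ≠ x₂ is given (up to order) by this formula. -/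
/-- Closed-form solution for the asymptotically period-two points of the generalized
fractional logistic map: with `K_C = Γ(α)/(h^α S₂₂)` and
`G⁰(x) = (h^α/Γ(α))(x − Kx(1−x))`, if `(K−1)² ≥ K_C²` then the pair
`x_{1,2} = (K_C + K − 1 ± √((K−1)² − K_C²))/(2K)` satisfies the asymptotic period-2 system
`G⁰(x₁) + G⁰(x₂) = 0`, `x₂ − x₁ = −S₂₂ G⁰(x₁) + S₂₂ G⁰(x₂)`; conversely, every real
solution of the system with `x₁ ≠ x₂` is given, up to order, by this formula. -/
theorem period_two_points_closed_form
    (α h S22 K : ℝ) (hα0 : 0 < α) (hα1 : α < 1) (hh : 0 < h)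
    (hS : 0 < S22) (hK : K ≠ 0)
    (KC : ℝ) (hKC : KC = Real.Gamma α / (h ^ α * S22))
    (G0 : ℝ → ℝ) (hG0 : ∀ x : ℝ, G0 x = (h ^ α / Real.Gamma α) * (x - K * x * (1 - x)))
    (xp xm : ℝ)
    (hxp : xp = (KC + K - 1 + Real.sqrt ((K - 1) ^ 2 - KC ^ 2)) / (2 * K))
    (hxm : xm = (KC + K - 1 - Real.sqrt ((K - 1) ^ 2 - KC ^ 2)) / (2 * K)) :
    ((K - 1) ^ 2 ≥ KC ^ 2 →
      (G0 xp + G0 xm = 0 ∧ xm - xp = -S22 * G0 xp + S22 * G0 xm)) ∧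
    (∀ x1 x2 : ℝ, x1 ≠ x2 →
      G0 x1 + G0 x2 = 0 → x2 - x1 = -S22 * G0 x1 + S22 * G0 x2 →
      (x1 = xp ∧ x2 = xm) ∨ (x1 = xm ∧ x2 = xp)) := by
  have hΓ : 0 < Real.Gamma α := Real.Gamma_pos_of_pos hα0
  have hp : 0 < h ^ α := Real.rpow_pos_of_pos hh α
  obtain ⟨c, hc⟩ : ∃ c, c = h ^ α / Real.Gamma α := ⟨_, rfl⟩
  have hc0 : c ≠ 0 := by rw [hc]; positivity
  have hinv : KC * (S22 * c) = 1 := by rw [hKC, hc]; field_simp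
  simp only [hG0, ← hc]
  constructor
  · intro hd
    have hs := Real.sq_sqrt (sub_nonneg.mpr hd)
    generalize Real.sqrt ((K - 1) ^ 2 - KC ^ 2) = r at hxp hxm hs
    have hsum : K * (xp + xm) = KC + K - 1 := by rw [hxp, hxm]; field_simp; ring
    have hdiff : K * (xp - xm) = r := by rw [hxp, hxm]; field_simp; ring
    constructor
    · have hf : K * ((xp - K * xp * (1 - xp)) + (xm - K * xm * (1 - xm))) = 0 := by
        rw [← hdiff] at hs
        linear_combination hs / 2 +
          ((1 - K) + (K * (xp + xm) + (KC + K - 1)) / 2) * hsum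
      have hf' := (mul_eq_zero.mp hf).resolve_left hK
      linear_combination c * hf'
    · linear_combination (xp - xm) * hinv + S22 * c * (xp - xm) * hsum
  · intro x1 x2 hne h1 h2
    have hf : (x1 - K * x1 * (1 - x1)) + (x2 - K * x2 * (1 - x2)) = 0 :=
      (mul_eq_zero.mp (by linear_combination h1 :
        c * ((x1 - K * x1 * (1 - x1)) + (x2 - K * x2 * (1 - x2))) = 0)).resolve_left hc0
    have hsum : K * (x1 + x2) = KC + K - 1 := by
      apply mul_left_cancel₀ (sub_ne_zero.mpr hne)
      linear_combination KC * h2 - (x1 - x2) * (K * (x1 + x2) + 1 - K) * hinv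
    have hsq : (K - 1) ^ 2 - KC ^ 2 = (K * (x1 - x2)) ^ 2 := by
      linear_combination -2 * K * hf +
        (2 * (1 - K) + (K * (x1 + x2) + (KC + K - 1))) * hsum
    rw [hsq, Real.sqrt_sq_eq_abs] at hxp hxm
    rcases abs_choice (K * (x1 - x2)) with ha | ha <;> rw [ha] at hxp hxm
    · left
      constructor
      · rw [hxp]; field_simp; linear_combination hsum
      · rw [hxm]; field_simp; linear_combination hsum
    · right
      constructor
      · rw [hxm]; field_simp; linear_combination hsum
      · rw [hxp]; field_simp; linear_combination hsum
end

section
/- Let 0 < α < 1, let G : ℝ → ℝ be continuous, and let U : ℤ → ℝ satisfy U(n) = 0 for n ≤ 0, Σ_{k=1}^{∞} |U(k+1) − U(k)| < ∞, and |Σ_{k=1}^{N} U(k)| → ∞ as N → ∞. Define the trajectory x_{n+1} = x₀ − Σ_{k=0}^{n} G(x_k)·U(n−k+1) and set S_{j+1,l} := Σ_{k=0}^{∞} [U(lk+j) − U(lk+j+1)] for 0 ≤ j < l. Let l ≥ 1 be an integer and suppose that for each k ∈ {1, …, l} the limit x_{lim,k} = lim_{N→∞} x_{Nl+k} exists. Then: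 (i) Σ_{j=1}^{l} G(x_{lim,j}) = 0, and (ii) for every k with 1 ≤ k < l, x_{lim,k+1} − x_{lim,k} = S_{1,l}·G(x_{lim,k}) + Σ_{j=1}^{k−1} S_{j+1,l}·G(x_{lim,k−j}) + Σ_{j=k}^{l−1} S_{j+1,l}·G(x_{lim,k−j+l}). -/
open Filter Finset

/-- A sequence with convergent subsequences along all residue classes is asymptotically
periodic. -/
lemma tendsto_sub_mod_of_residue_limits {l : ℕ} (hl : 1 ≤ l) {f c : ℕ → ℝ}
    (h : ∀ k < l, Tendsto (fun N : ℕ => f (N * l + k)) atTop (nhds (c k))) :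
    Tendsto (fun n => f n - c (n % l)) atTop (nhds 0) := by
  rw [Metric.tendsto_atTop]
  intro ε hε
  have h1 : ∀ k, ∃ M : ℕ, k < l → ∀ N ≥ M, dist (f (N * l + k)) (c k) < ε := by
    intro k
    by_cases hk : k < l
    · obtain ⟨M, hM⟩ := Metric.tendsto_atTop.1 (h k hk) ε hε
      exact ⟨M, fun _ => hM⟩
    · exact ⟨0, fun h => absurd h hk⟩
  choose M hM using h1
  refine ⟨(∑ k ∈ range l, M k) * l, fun n hn => ?_⟩
  have hmod : n % l < l := Nat.mod_lt _ hl
  have h2 : M (n % l) ≤ ∑ k ∈ range l, M k :=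
    single_le_sum (f := M) (fun _ _ => Nat.zero_le _) (mem_range.2 hmod)
  have h3 : ∑ k ∈ range l, M k ≤ n / l := (Nat.le_div_iff_mul_le hl).2 hn
  have h4 := hM (n % l) hmod (n / l) (h2.trans h3)
  rw [Nat.div_add_mod' n l] at h4
  simpa [Real.dist_eq] using h4

lemma exists_abs_le_of_residue_limits {l : ℕ} (hl : 1 ≤ l) {f c : ℕ → ℝ}
    (h : ∀ k < l, Tendsto (fun N : ℕ => f (N * l + k)) atTop (nhds (c k))) :
    ∃ B, ∀ n, |f n| ≤ B := by
  obtain ⟨A, hA⟩ := (Metric.isBounded_range_of_tendsto _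
    (tendsto_sub_mod_of_residue_limits hl h)).exists_norm_le
  refine ⟨A + ∑ k ∈ range l, |c k|, fun n => ?_⟩
  have h1 : |f n - c (n % l)| ≤ A := hA _ ⟨n, rfl⟩
  have h2 : |c (n % l)| ≤ ∑ k ∈ range l, |c k| :=
    single_le_sum (f := fun k => |c k|) (fun _ _ => abs_nonneg _)
      (mem_range.2 (Nat.mod_lt _ hl))
  have h3 := abs_add_le (f n - c (n % l)) (c (n % l))
  rw [sub_add_cancel] at h3
  linarith

lemma exists_abs_le_of_shift {f : ℕ → ℝ} (h : ∃ B, ∀ n, |f (n + 1)| ≤ B) :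
    ∃ B, ∀ n, |f n| ≤ B := by
  obtain ⟨B, hB⟩ := h
  refine ⟨max B |f 0|, fun n => ?_⟩
  cases n with
  | zero => exact le_max_right _ _
  | succ n => exact (hB n).trans (le_max_left _ _)

lemma exists_abs_le_of_summable_abs_sub {u : ℕ → ℝ}
    (h : Summable fun k => |u (k + 1) - u k|) : ∃ B, ∀ n, |u n| ≤ B := by
  refine ⟨|u 0| + ∑' k, |u (k + 1) - u k|, fun n => ?_⟩
  have h1 : ∑ k ∈ range n, (u (k + 1) - u k) = u n - u 0 := sum_range_sub u n
  have h2 : |u n - u 0| ≤ ∑ k ∈ range n, |u (k + 1) - u k| := by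
    rw [← h1]; exact abs_sum_le_sum_abs _ _
  have h3 := h.sum_le_tsum (range n) (fun _ _ => abs_nonneg _)
  have h4 := abs_add_le (u n - u 0) (u 0)
  rw [sub_add_cancel] at h4
  linarith

lemma summable_norm_mul_pow_of_abs_le {a : ℕ → ℝ} {A z : ℝ} (ha : ∀ n, |a n| ≤ A)
    (hz0 : 0 ≤ z) (hz1 : z < 1) : Summable fun n => ‖a n * z ^ n‖ := by
  refine Summable.of_nonneg_of_le (fun _ => norm_nonneg _) (fun n => ?_)
    ((summable_geometric_of_lt_one hz0 hz1).mul_left A)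
  rw [norm_mul, norm_pow, Real.norm_of_nonneg hz0]
  exact mul_le_mul_of_nonneg_right (ha n) (pow_nonneg hz0 n)

lemma abs_tsum_mul_pow_le {a : ℕ → ℝ} {A z : ℝ} (ha : ∀ n, |a n| ≤ A)
    (hz0 : 0 ≤ z) (hz1 : z < 1) : (1 - z) * |∑' n, a n * z ^ n| ≤ A := by
  have h1 := norm_tsum_le_tsum_norm (summable_norm_mul_pow_of_abs_le ha hz0 hz1)
  have h2 : ∑' n, ‖a n * z ^ n‖ ≤ ∑' n, A * z ^ n := by
    refine Summable.tsum_le_tsum (fun n => ?_) (summable_norm_mul_pow_of_abs_le ha hz0 hz1)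
      ((summable_geometric_of_lt_one hz0 hz1).mul_left A)
    rw [norm_mul, norm_pow, Real.norm_of_nonneg hz0]
    exact mul_le_mul_of_nonneg_right (ha n) (pow_nonneg hz0 n)
  rw [tsum_mul_left, tsum_geometric_of_lt_one hz0 hz1] at h2
  have h3 : 0 < 1 - z := by linarith
  calc (1 - z) * |∑' n, a n * z ^ n| ≤ (1 - z) * (A * (1 - z)⁻¹) :=
        mul_le_mul_of_nonneg_left (h1.trans h2) h3.le
    _ = A := by field_simp

/-- Cauchy product of the generating functions of two bounded sequences. -/
lemma hasSum_convolution_mul_pow {a b : ℕ → ℝ} {A B z : ℝ} (ha : ∀ n, |a n| ≤ A)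
    (hb : ∀ n, |b n| ≤ B) (hz0 : 0 ≤ z) (hz1 : z < 1) :
    HasSum (fun n => (∑ k ∈ range (n + 1), a k * b (n - k)) * z ^ n)
      ((∑' n, a n * z ^ n) * ∑' n, b n * z ^ n) := by
  have hsa := summable_norm_mul_pow_of_abs_le ha hz0 hz1
  have hsb := summable_norm_mul_pow_of_abs_le hb hz0 hz1
  have h1 : ∀ n, ∑ k ∈ range (n + 1), a k * z ^ k * (b (n - k) * z ^ (n - k)) =
      (∑ k ∈ range (n + 1), a k * b (n - k)) * z ^ n := by
    intro n
    rw [sum_mul]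
    refine sum_congr rfl fun k hk => ?_
    have : k + (n - k) = n := by have := mem_range.1 hk; omega
    rw [← this, pow_add, this]
    ring
  have h2 := tsum_mul_tsum_eq_tsum_sum_range_of_summable_norm hsa hsb
  have h3 := (summable_norm_sum_mul_range_of_summable_norm hsa hsb).of_norm
  rw [h2]
  simp only [h1] at h3 ⊢
  exact h3.hasSum

/-- An eventual lower bound on a sequence passes to its Abel means. -/
lemma eventually_lt_abel_mean {a : ℕ → ℝ} {C C' : ℝ} (hC : C' < C)
    (hs : ∀ z : ℝ, 0 ≤ z → z < 1 → Summable fun n => a n * z ^ n)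
    (ha : ∀ᶠ n in atTop, C ≤ a n) :
    ∀ᶠ z in nhdsWithin (1 : ℝ) (Set.Iio 1), C' < (1 - z) * ∑' n, a n * z ^ n := by
  obtain ⟨N, hN⟩ := eventually_atTop.1 ha
  have hcont : Tendsto (fun z : ℝ => (1 - z) * ∑ n ∈ range N, (a n - C) * z ^ n)
      (nhdsWithin (1 : ℝ) (Set.Iio 1)) (nhds 0) := by
    have : Continuous fun z : ℝ => (1 - z) * ∑ n ∈ range N, (a n - C) * z ^ n := by fun_prop
    have h := this.tendsto 1
    simp only [sub_self, zero_mul] at h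
    exact h.mono_left nhdsWithin_le_nhds
  have hpos : ∀ᶠ z in nhdsWithin (1 : ℝ) (Set.Iio 1), (0 : ℝ) < z :=
    nhdsWithin_le_nhds (lt_mem_nhds zero_lt_one)
  filter_upwards [hcont.eventually (lt_mem_nhds (show C' - C < 0 by linarith)), hpos,
    self_mem_nhdsWithin] with z h1 hz0 hz1
  have hz1 : z < 1 := hz1
  have hgeo := (summable_geometric_of_lt_one hz0.le hz1).mul_left C
  have hsub : Summable fun n => (a n - C) * z ^ n := by
    simpa only [sub_mul] using (hs z hz0.le hz1).sub hgeo
  have h2 : ∑ n ∈ range N, (a n - C) * z ^ n ≤ ∑' n, (a n - C) * z ^ n := by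
    refine hsub.sum_le_tsum _ fun n hn => ?_
    have : N ≤ n := by simpa using hn
    exact mul_nonneg (sub_nonneg.2 (hN n this)) (pow_nonneg hz0.le n)
  have h3 : ∑' n, (a n - C) * z ^ n = ∑' n, a n * z ^ n - C * (1 - z)⁻¹ := by
    simp only [sub_mul]
    rw [(hs z hz0.le hz1).tsum_sub hgeo, tsum_mul_left, tsum_geometric_of_lt_one hz0.le hz1]
  have hz : 0 < 1 - z := by linarith
  have h4 := mul_le_mul_of_nonneg_left h2 hz.le
  have h5 : (1 - z) * (C * (1 - z)⁻¹) = C := by field_simp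
  rw [h3, mul_sub, h5] at h4
  linarith

/-- If `|s n| → ∞` and the increments of `s` are bounded, then `s → ∞` or `s → -∞`. -/
lemma tendsto_atTop_or_atBot_of_abs {s : ℕ → ℝ} {B : ℝ} (hB : ∀ n, |s (n + 1) - s n| ≤ B)
    (h : Tendsto (fun n => |s n|) atTop atTop) :
    Tendsto s atTop atTop ∨ Tendsto (fun n => -s n) atTop atTop := by
  obtain ⟨N, hN⟩ := eventually_atTop.1 (h.eventually (eventually_gt_atTop B))
  have hB0 : 0 ≤ B := (abs_nonneg _).trans (hB 0)
  rcases le_total 0 (s N) with h0 | h0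
  · left
    have hs : ∀ n ≥ N, 0 ≤ s n := by
      intro n hn
      induction n, hn using Nat.le_induction with
      | base => exact h0
      | succ n hn ih =>
        have h1 := hN n hn
        rw [abs_of_nonneg ih] at h1
        have h2 := (abs_le.1 (hB n)).1
        linarith
    refine h.congr' ?_
    filter_upwards [eventually_ge_atTop N] with n hn using abs_of_nonneg (hs n hn)
  · right
    have hs : ∀ n ≥ N, s n ≤ 0 := by
      intro n hn
      induction n, hn using Nat.le_induction with
      | base => exact h0
      | succ n hn ih =>
        have h1 := hN n hn
        rw [abs_of_nonpos ih] at h1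
        have h2 := (abs_le.1 (hB n)).2
        linarith
    refine h.congr' ?_
    filter_upwards [eventually_ge_atTop N] with n hn using abs_of_nonpos (hs n hn)

/-- The generating function of a bounded sequence whose partial sums diverge to infinity in
absolute value is unbounded near `1`. -/
lemma eventually_lt_abs_tsum_mul_pow {u : ℕ → ℝ} {B : ℝ} (hB : ∀ n, |u n| ≤ B)
    (h : Tendsto (fun n => |∑ k ∈ range (n + 1), u k|) atTop atTop) (C : ℝ) :
    ∀ᶠ z in nhdsWithin (1 : ℝ) (Set.Iio 1), C < |∑' n, u n * z ^ n| := by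
  have hpos : ∀ᶠ z in nhdsWithin (1 : ℝ) (Set.Iio 1), (0 : ℝ) < z :=
    nhdsWithin_le_nhds (lt_mem_nhds zero_lt_one)
  have hsum : ∀ z : ℝ, 0 ≤ z → z < 1 →
      HasSum (fun n => (∑ k ∈ range (n + 1), u k) * z ^ n)
        ((∑' n, u n * z ^ n) * (1 - z)⁻¹) := by
    intro z hz0 hz1
    have := hasSum_convolution_mul_pow (b := fun _ => 1) (B := 1) hB (by simp) hz0 hz1
    simpa [tsum_geometric_of_lt_one hz0 hz1] using this
  have hdiff : ∀ n, |∑ k ∈ range (n + 1 + 1), u k - ∑ k ∈ range (n + 1), u k| ≤ B := by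
    intro n
    rw [sum_range_succ _ (n + 1), add_sub_cancel_left]
    exact hB _
  rcases tendsto_atTop_or_atBot_of_abs (s := fun n => ∑ k ∈ range (n + 1), u k) hdiff h
    with h1 | h1
  · filter_upwards [eventually_lt_abel_mean (lt_add_one C)
      (fun z hz0 hz1 => (hsum z hz0 hz1).summable) (h1.eventually (eventually_ge_atTop (C + 1))),
      hpos, self_mem_nhdsWithin] with z hz hz0 hz1
    have hz1 : z < 1 := hz1
    have : 1 - z ≠ 0 := by linarith
    rw [(hsum z hz0.le hz1).tsum_eq, mul_comm, inv_mul_cancel_right₀ this] at hz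
    exact hz.trans_le (le_abs_self _)
  · have hneg : ∀ z : ℝ, 0 ≤ z → z < 1 →
        HasSum (fun n => (-∑ k ∈ range (n + 1), u k) * z ^ n)
          (-((∑' n, u n * z ^ n) * (1 - z)⁻¹)) := by
      intro z hz0 hz1
      simpa only [neg_mul] using (hsum z hz0 hz1).neg
    filter_upwards [eventually_lt_abel_mean (lt_add_one C)
      (fun z hz0 hz1 => (hneg z hz0 hz1).summable) (h1.eventually (eventually_ge_atTop (C + 1))),
      hpos, self_mem_nhdsWithin] with z hz hz0 hz1
    have hz1 : z < 1 := hz1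
    have : 1 - z ≠ 0 := by linarith
    rw [(hneg z hz0.le hz1).tsum_eq, ← neg_mul, mul_comm, inv_mul_cancel_right₀ this] at hz
    exact hz.trans_le (neg_le_abs _)

/-- If moving sums of length `l` of `g` tend to `σ > 0`, then the convolution of `g` with a
bounded sequence whose partial sums diverge in absolute value is unbounded. -/
lemma moving_sum_limit_nonpos {g u : ℕ → ℝ} {A B D σ : ℝ} {l : ℕ}
    (hg : ∀ n, |g n| ≤ A) (hu : ∀ n, |u n| ≤ B)
    (hdiv : Tendsto (fun n => |∑ k ∈ range (n + 1), u k|) atTop atTop)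
    (hconv : ∀ n, |∑ k ∈ range (n + 1), g k * u (n - k)| ≤ D)
    (hσ : Tendsto (fun m => ∑ i ∈ range l, g (m + 1 + i)) atTop (nhds σ)) : σ ≤ 0 := by
  by_contra! hpos
  set w : ℕ → ℝ := fun i => if i < l then 1 else 0 with hw
  have hw1 : ∀ n, |w n| ≤ 1 := by
    intro n
    simp only [hw]
    split_ifs <;> simp
  have hwz : ∀ z : ℝ, 0 ≤ z → z < 1 → |∑' n, w n * z ^ n| ≤ l := by
    intro z hz0 hz1
    rw [tsum_eq_sum (s := range l) (fun n hn => by simp [hw] at hn ⊢; intro h; omega)]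
    refine (abs_sum_le_sum_abs _ _).trans ?_
    calc ∑ i ∈ range l, |w i * z ^ i| ≤ ∑ i ∈ range l, (1 : ℝ) := by
          refine sum_le_sum fun i _ => ?_
          rw [abs_mul, abs_of_nonneg (pow_nonneg hz0 i)]
          exact mul_le_one₀ (hw1 i) (pow_nonneg hz0 i) (pow_le_one₀ hz0 hz1.le)
      _ = l := by simp
  have hmov : ∀ m, ∑ k ∈ range (m + l + 1), g k * w (m + l - k) =
      ∑ i ∈ range l, g (m + 1 + i) := by
    intro m
    rw [show m + l + 1 = (m + 1) + l by ring, sum_range_add, sum_eq_zero, zero_add]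
    · refine sum_congr rfl fun i hi => ?_
      have := mem_range.1 hi
      rw [hw]
      simp only
      rw [if_pos (by omega), mul_one]
    · intro i hi
      have := mem_range.1 hi
      rw [hw]
      simp only
      rw [if_neg (by omega), mul_zero]
  have hlow : ∀ᶠ n in atTop, σ / 2 ≤ ∑ k ∈ range (n + 1), g k * w (n - k) := by
    obtain ⟨M, hM⟩ := eventually_atTop.1 (hσ.eventually (lt_mem_nhds (half_lt_self hpos)))
    filter_upwards [eventually_ge_atTop (M + l)] with n hn
    obtain ⟨m, rfl⟩ := Nat.exists_eq_add_of_le' (show l ≤ n by omega)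
    rw [hmov]
    exact (hM m (by omega)).le
  have hposz : ∀ᶠ z in nhdsWithin (1 : ℝ) (Set.Iio 1), (0 : ℝ) < z :=
    nhdsWithin_le_nhds (lt_mem_nhds zero_lt_one)
  have habel := eventually_lt_abel_mean (show σ / 4 < σ / 2 by linarith)
    (fun z hz0 hz1 => (hasSum_convolution_mul_pow hg hw1 hz0 hz1).summable) hlow
  obtain ⟨z, h1, h2, hz0, hz1⟩ := (habel.and ((eventually_lt_abs_tsum_mul_pow hu hdiv
    (l * D / (σ / 4))).and (hposz.and self_mem_nhdsWithin))).exists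
  have hz1 : z < 1 := hz1
  have hz : 0 < 1 - z := by linarith
  rw [(hasSum_convolution_mul_pow hg hw1 hz0.le hz1).tsum_eq] at h1
  have h3 := abs_tsum_mul_pow_le hconv hz0.le hz1
  rw [(hasSum_convolution_mul_pow hg hu hz0.le hz1).tsum_eq, abs_mul] at h3
  have h4 := hwz z hz0.le hz1
  set P := ∑' n, g n * z ^ n
  set Q := ∑' n, u n * z ^ n
  set R := ∑' n, w n * z ^ n
  have h5 : σ / 4 < (1 - z) * (|P| * l) := by
    refine h1.trans_le (mul_le_mul_of_nonneg_left ?_ hz.le)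
    calc P * R ≤ |P * R| := le_abs_self _
      _ = |P| * |R| := abs_mul _ _
      _ ≤ |P| * l := mul_le_mul_of_nonneg_left h4 (abs_nonneg _)
  rw [div_lt_iff₀ (by linarith)] at h2
  have h6 : |Q| * (σ / 4) ≤ |Q| * ((1 - z) * (|P| * l)) :=
    mul_le_mul_of_nonneg_left h5.le (abs_nonneg _)
  have h7 : (l : ℝ) * ((1 - z) * (|P| * |Q|)) ≤ l * D :=
    mul_le_mul_of_nonneg_left h3 (Nat.cast_nonneg l)
  nlinarith

lemma sum_range_add_mod (c : ℕ → ℝ) (l m : ℕ) :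
    ∑ i ∈ range l, c ((m + i) % l) = ∑ i ∈ range l, c i := by
  induction m with
  | zero =>
    refine sum_congr rfl fun i hi => ?_
    rw [zero_add, Nat.mod_eq_of_lt (mem_range.1 hi)]
  | succ m ih =>
    rw [← ih]
    have h1 := sum_range_succ (fun i => c ((m + i) % l)) l
    have h2 := sum_range_succ' (fun i => c ((m + i) % l)) l
    simp only [Nat.add_mod_right, add_zero] at h1 h2
    have h3 : ∑ i ∈ range l, c ((m + 1 + i) % l) = ∑ i ∈ range l, c ((m + (i + 1)) % l) :=
      sum_congr rfl fun i _ => by rw [add_assoc, add_comm 1 i]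
    linarith

lemma tsum_mul_mod_eq_sum {d : ℕ → ℝ} {l : ℕ} (hl : 1 ≤ l) (e : ℕ → ℝ)
    (hde : Summable fun m => d m * e (m % l)) :
    ∑' m, d m * e (m % l) = ∑ j ∈ range l, (∑' q, d (l * q + j)) * e j := by
  obtain ⟨l, rfl⟩ := Nat.exists_eq_add_of_le' hl
  rw [Nat.sumByResidueClasses hde (l + 1)]
  rw [← Fin.sum_univ_eq_sum_range (fun j => (∑' q, d ((l + 1) * q + j)) * e j)]
  refine sum_congr rfl fun (j : Fin (l + 1)) _ => ?_
  rw [← tsum_mul_right]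
  refine tsum_congr fun q => ?_
  change d (j.val + (l + 1) * q) * e ((j.val + (l + 1) * q) % (l + 1)) = _
  rw [Nat.add_mul_mod_self_left, Nat.mod_eq_of_lt j.2, add_comm]

/-- Equations defining asymptotically period-`l` points of generalized fractional maps of
orders `0 < α < 1` written as Volterra difference equations of convolution type
`x_{n+1} = x₀ − Σ_{k=0}^{n} G(x_k) U(n−k+1)`: if the limits
`x_{lim,k} = lim_{N→∞} x_{Nl+k}` exist for `k = 1, …, l`, then
(i) `Σ_{j=1}^{l} G(x_{lim,j}) = 0`, and (ii) for `1 ≤ k < l`,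
`x_{lim,k+1} − x_{lim,k} = S_{1,l} G(x_{lim,k}) + Σ_{j=1}^{k−1} S_{j+1,l} G(x_{lim,k−j})
+ Σ_{j=k}^{l−1} S_{j+1,l} G(x_{lim,k−j+l})`,
where `S_{j+1,l} = Σ_{k=0}^∞ [U(lk+j) − U(lk+j+1)]`. -/
theorem asymptotically_periodic_points_equations
    (α : ℝ) (hα0 : 0 < α) (hα1 : α < 1)
    (G : ℝ → ℝ) (hG : Continuous G)
    (U : ℤ → ℝ)
    (hU0 : ∀ n : ℤ, n ≤ 0 → U n = 0)
    (hUdiff : Summable fun k : ℕ => |U ((k : ℤ) + 2) - U ((k : ℤ) + 1)|)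
    (hUdiv : Tendsto (fun N : ℕ => |∑ k ∈ Icc 1 N, U (k : ℤ)|) atTop atTop)
    (x : ℕ → ℝ)
    (hx : ∀ n : ℕ, x (n + 1) = x 0 - ∑ k ∈ range (n + 1), G (x k) * U ((n : ℤ) - k + 1))
    (l : ℕ) (hl : 1 ≤ l)
    (S : ℕ → ℝ)
    (hS : ∀ j : ℕ, S j = ∑' k : ℕ, (U ((l : ℤ) * k + j) - U ((l : ℤ) * k + j + 1)))
    (xlim : ℕ → ℝ)
    (hlim : ∀ k ∈ Icc 1 l, Tendsto (fun N : ℕ => x (N * l + k)) atTop (nhds (xlim k))) :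
    (∑ j ∈ Icc 1 l, G (xlim j) = 0) ∧
    (∀ k : ℕ, 1 ≤ k → k < l →
      xlim (k + 1) - xlim k =
        S 0 * G (xlim k) + (∑ j ∈ Icc 1 (k - 1), S j * G (xlim (k - j))) +
          ∑ j ∈ Icc k (l - 1), S j * G (xlim (k + l - j))) := by
  have hGlim : ∀ k ∈ Icc 1 l,
      Tendsto (fun N : ℕ => G (x (N * l + k))) atTop (nhds (G (xlim k))) :=
    fun k hk => (hG.tendsto _).comp (hlim k hk)
  have hglim : ∀ k < l,
      Tendsto (fun N : ℕ => G (x (N * l + k + 1))) atTop (nhds (G (xlim (k + 1)))) :=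
    fun k hk => hGlim (k + 1) (mem_Icc.2 ⟨by omega, by omega⟩)
  obtain ⟨A, hA⟩ := exists_abs_le_of_shift (f := fun n => G (x n))
    (exists_abs_le_of_residue_limits (f := fun n => G (x (n + 1)))
      (c := fun k => G (xlim (k + 1))) hl hglim)
  obtain ⟨X, hX⟩ := exists_abs_le_of_shift (f := x)
    (exists_abs_le_of_residue_limits (f := fun n => x (n + 1))
      (c := fun k => xlim (k + 1)) hl
      fun k hk => hlim (k + 1) (mem_Icc.2 ⟨by omega, by omega⟩))
  constructor
  · set u : ℕ → ℝ := fun n => U ((n : ℤ) + 1) with hu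
    obtain ⟨B, hB⟩ := exists_abs_le_of_summable_abs_sub (u := u) (by
      refine hUdiff.congr fun k => ?_
      simp only [hu]
      push_cast
      rw [add_assoc, one_add_one_eq_two])
    have hdiv : Tendsto (fun n => |∑ k ∈ range (n + 1), u k|) atTop atTop := by
      refine (hUdiv.comp (tendsto_add_atTop_nat 1)).congr fun n => ?_
      simp only [Function.comp_apply]
      rw [← Finset.Ico_succ_right_eq_Icc, sum_Ico_eq_sum_range]
      congr 1
      refine sum_congr (by simp) fun k _ => ?_
      simp only [hu]
      push_cast
      rw [add_comm]
    have hconv : ∀ n, |∑ k ∈ range (n + 1), G (x k) * u (n - k)| ≤ X + X := by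
      intro n
      have h1 : ∑ k ∈ range (n + 1), G (x k) * u (n - k) = x 0 - x (n + 1) := by
        rw [hx n, sub_sub_cancel]
        refine sum_congr rfl fun k hk => ?_
        have : k ≤ n := by have := mem_range.1 hk; omega
        simp only [hu]
        rw [Nat.cast_sub this]
      rw [h1]
      exact (abs_sub _ _).trans (add_le_add (hX _) (hX _))
    have hσ : Tendsto (fun m => ∑ i ∈ range l, G (x (m + 1 + i))) atTop
        (nhds (∑ j ∈ Icc 1 l, G (xlim j))) := by
      have h0 := tendsto_sub_mod_of_residue_limits (f := fun n => G (x (n + 1)))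
        (c := fun k => G (xlim (k + 1))) hl hglim
      have h1 : Tendsto (fun m => ∑ i ∈ range l,
          (G (x (m + i + 1)) - G (xlim ((m + i) % l + 1)))) atTop (nhds 0) := by
        have := tendsto_finsetSum (range l) fun i _ => h0.comp (tendsto_add_atTop_nat i)
        simpa using this
      have h2 := h1.add_const (∑ j ∈ Icc 1 l, G (xlim j))
      rw [zero_add] at h2
      refine h2.congr fun m => ?_
      rw [sum_sub_distrib, sum_range_add_mod (fun i => G (xlim (i + 1))),
        ← Finset.Ico_succ_right_eq_Icc, sum_Ico_eq_sum_range]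
      simp only [Nat.succ_eq_succ, Nat.succ_sub_one, add_comm 1, sub_add_cancel, add_right_comm m 1]
    refine le_antisymm (moving_sum_limit_nonpos hA hB hdiv hconv hσ) ?_
    have := moving_sum_limit_nonpos (g := fun n => -G (x n)) (by simpa using hA) hB hdiv
      (by simpa using hconv) (l := l)
      (σ := -∑ j ∈ Icc 1 l, G (xlim j)) (by simpa only [sum_neg_distrib] using hσ.neg)
    linarith
  · intro k hk1 hkl
    set d : ℕ → ℝ := fun m => U (m : ℤ) - U ((m : ℤ) + 1) with hd
    have hdabs : Summable fun m => |d m| := by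
      rw [← summable_nat_add_iff 1]
      refine hUdiff.congr fun m => ?_
      simp only [hd]
      push_cast
      rw [add_assoc, one_add_one_eq_two, abs_sub_comm]
    set e : ℕ → ℝ := fun j => if j < k then G (xlim (k - j)) else G (xlim (k + l - j)) with he
    have hstep : ∀ n, 1 ≤ n →
        x (n + 1) - x n = ∑ m ∈ range (n + 1), d m * G (x (n - m)) := by
      intro n hn
      obtain ⟨n, rfl⟩ := Nat.exists_eq_add_of_le' hn
      rw [← sum_range_reflect, hx (n + 1), hx n, sub_sub_sub_cancel_left]
      have h1 : ∑ j ∈ range (n + 1), G (x j) * U ((n : ℤ) - j + 1) =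
          ∑ j ∈ range (n + 1 + 1), G (x j) * U ((n : ℤ) - j + 1) := by
        rw [sum_range_succ _ (n + 1), hU0 ((n : ℤ) - (n + 1 : ℕ) + 1) (by push_cast; omega)]
        simp
      rw [h1, ← sum_sub_distrib]
      refine sum_congr rfl fun j hj => ?_
      have hj' : j ≤ n + 1 := by have := mem_range.1 hj; omega
      have h2 : n + 1 + 1 - 1 - j = n + 1 - j := by omega
      have h3 : n + 1 - (n + 1 - j) = j := by omega
      simp only [hd]
      rw [h2, h3, Nat.cast_sub hj']
      push_cast
      rw [show (n : ℤ) + 1 - j = n - j + 1 by ring]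
      ring
    have hres : ∀ m, Tendsto (fun N : ℕ => G (x (N * l + k - m))) atTop (nhds (e (m % l))) := by
      intro m
      have hmod : m % l < l := Nat.mod_lt _ hl
      have hm := Nat.div_add_mod' m l
      simp only [he]
      split_ifs with hjk
      · refine ((hGlim (k - m % l) (mem_Icc.2 ⟨by omega, by omega⟩)).comp
          (tendsto_sub_atTop_nat (m / l))).congr' ?_
        filter_upwards [eventually_ge_atTop (m / l)] with N hN
        obtain ⟨r, rfl⟩ := Nat.exists_eq_add_of_le' hN
        simp only [Function.comp_apply]
        congr 2
        rw [Nat.add_sub_cancel, add_mul]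
        omega
      · refine ((hGlim (k + l - m % l) (mem_Icc.2 ⟨by omega, by omega⟩)).comp
          (tendsto_sub_atTop_nat (m / l + 1))).congr' ?_
        filter_upwards [eventually_ge_atTop (m / l + 1)] with N hN
        obtain ⟨r, rfl⟩ := Nat.exists_eq_add_of_le' hN
        simp only [Function.comp_apply]
        congr 2
        rw [Nat.add_sub_cancel, add_mul, add_mul, one_mul]
        omega
    have heA : ∀ m, |e (m % l)| ≤ A := fun m =>
      le_of_tendsto (hres m).abs (Eventually.of_forall fun N => hA _)
    have hde : Summable fun m => d m * e (m % l) := by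
      refine Summable.of_norm_bounded (hdabs.mul_right A) fun m => ?_
      rw [norm_mul]
      exact mul_le_mul_of_nonneg_left (heA m) (abs_nonneg _)
    have hdom : Tendsto (fun N : ℕ => ∑' m, if m < N * l + k + 1 then
        d m * G (x (N * l + k - m)) else 0) atTop (nhds (∑' m, d m * e (m % l))) := by
      refine tendsto_tsum_of_dominated_convergence (hdabs.mul_right A) (fun m => ?_)
        (Eventually.of_forall fun N m => ?_)
      · refine ((hres m).const_mul (d m)).congr' ?_
        filter_upwards [eventually_ge_atTop m] with N hN
        rw [if_pos]
        have := Nat.le_mul_of_pos_right N hl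
        omega
      · split_ifs
        · rw [norm_mul]
          exact mul_le_mul_of_nonneg_left (hA _) (abs_nonneg _)
        · rw [norm_zero]
          exact mul_nonneg (abs_nonneg _) ((abs_nonneg _).trans (hA 0))
    have hdiff : Tendsto (fun N : ℕ => x (N * l + (k + 1)) - x (N * l + k)) atTop
        (nhds (xlim (k + 1) - xlim k)) :=
      (hlim (k + 1) (mem_Icc.2 ⟨by omega, by omega⟩)).sub (hlim k (mem_Icc.2 ⟨hk1, hkl.le⟩))
    have heq : xlim (k + 1) - xlim k = ∑' m, d m * e (m % l) := by
      refine tendsto_nhds_unique hdiff (hdom.congr fun N => ?_)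
      rw [← add_assoc, hstep (N * l + k) (by omega),
        tsum_eq_sum (s := range (N * l + k + 1)) fun m hm => if_neg (by simpa using hm)]
      exact sum_congr rfl fun m hm => if_pos (mem_range.1 hm)
    have hSd : ∀ j, S j = ∑' q, d (l * q + j) := by
      intro j
      rw [hS]
      simp only [hd]
      push_cast
      rfl
    rw [heq, tsum_mul_mod_eq_sum hl e hde]
    simp only [← hSd]
    have hIcc : ∀ a b : ℕ, 1 ≤ b → Icc a (b - 1) = Ico a b := by
      intro a b hb
      ext i
      simp only [mem_Icc, mem_Ico]
      omega
    rw [hIcc 1 k hk1, hIcc k l hl, range_eq_Ico, ← sum_Ico_consecutive _ (Nat.zero_le k) hkl.le,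
      sum_eq_sum_Ico_succ_bot hk1]
    congr 1
    · congr 1
      · simp only [he]
        rw [if_pos (Nat.pos_of_ne_zero (by omega)), Nat.sub_zero]
      · refine sum_congr rfl fun j hj => ?_
        simp only [he]
        rw [if_pos (mem_Ico.1 hj).2]
    · refine sum_congr rfl fun j hj => ?_
      simp only [he]
      rw [if_neg (not_lt.2 (mem_Ico.1 hj).1)]
end

section
/- Let 0 < α < 1, h > 0, S₂₂ > 0, K ∈ ℝ with K ≠ 0, and set K_C = Γ(α)/(h^α S₂₂) and G⁰(x) = (h^α/Γ(α))·(x − Kx(1−x)). The asymptotic period-2 system G⁰(x₁) + G⁰(x₂) = 0, x₂ − x₁ = −S₂₂·G⁰(x₁) + S₂₂·G⁰(x₂) has a real solution with x₁ ≠ x₂ if and only if (K−1)² > K_C², i.e. if and only if K > 1 + K_C or K < 1 − K_C. Consequently the asymptotic fixed-point–T=2 bifurcation points of the generalized fractional logistic map are K = 1 ± Γ(α)/(h^α S_{2,2}). -/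
/-- Existence criterion for asymptotically period-two points of the generalized fractional
logistic map: with `K_C = Γ(α)/(h^α S₂₂)` and `G⁰(x) = (h^α/Γ(α))(x − Kx(1−x))`, the
asymptotic period-2 system `G⁰(x₁) + G⁰(x₂) = 0`,
`x₂ − x₁ = −S₂₂ G⁰(x₁) + S₂₂ G⁰(x₂)` has a real solution with `x₁ ≠ x₂` if and only if
`(K−1)² > K_C²`, i.e. if and only if `K > 1 + K_C` or `K < 1 − K_C`; the asymptotic
fixed-point–T=2 bifurcation points are `K = 1 ± Γ(α)/(h^α S₂₂)`. -/
theorem period_two_existence_bifurcation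
    (α h S22 K : ℝ) (hα0 : 0 < α) (hα1 : α < 1) (hh : 0 < h)
    (hS : 0 < S22) (hK : K ≠ 0)
    (KC : ℝ) (hKC : KC = Real.Gamma α / (h ^ α * S22))
    (G0 : ℝ → ℝ) (hG0 : ∀ x : ℝ, G0 x = (h ^ α / Real.Gamma α) * (x - K * x * (1 - x))) :
    ((∃ x1 x2 : ℝ, x1 ≠ x2 ∧ G0 x1 + G0 x2 = 0 ∧
        x2 - x1 = -S22 * G0 x1 + S22 * G0 x2) ↔ (K - 1) ^ 2 > KC ^ 2) ∧
    ((K - 1) ^ 2 > KC ^ 2 ↔ (K > 1 + KC ∨ K < 1 - KC)) := by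
  have hΓ : 0 < Real.Gamma α := Real.Gamma_pos_of_pos hα0
  have hp : 0 < h ^ α := Real.rpow_pos_of_pos hh α
  have hKC0 : 0 < KC := hKC ▸ div_pos hΓ (mul_pos hp hS)
  have hG : ∀ x, KC * S22 * G0 x = x - K * x * (1 - x) := by
    intro x
    rw [hG0, hKC]
    field_simp
  have hKS : KC * S22 ≠ 0 := (mul_pos hKC0 hS).ne'
  refine ⟨⟨?_, ?_⟩, ?_⟩
  · rintro ⟨x1, x2, hne, hsum, hdiff⟩
    have hsub : x2 - x1 ≠ 0 := sub_ne_zero.mpr hne.symm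
    have hsum' : (1 - K) * (x1 + x2) + K * (x1 ^ 2 + x2 ^ 2) = 0 := by
      linear_combination KC * S22 * hsum - hG x1 - hG x2
    have hs : KC = 1 - K + K * (x1 + x2) := by
      apply mul_left_cancel₀ hsub
      linear_combination KC * hdiff - hG x1 + hG x2
    have hsq : (K - 1) ^ 2 - KC ^ 2 = (K * (x2 - x1)) ^ 2 := by
      rw [hs]
      linear_combination -2 * K * hsum'
    have := sq_pos_of_ne_zero (mul_ne_zero hK hsub)
    linarith
  · intro hlt
    have hD : 0 < (K - 1) ^ 2 - KC ^ 2 := sub_pos.mpr hlt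
    obtain ⟨D, hD0, hDsq⟩ : ∃ D : ℝ, 0 < D ∧ D ^ 2 = (K - 1) ^ 2 - KC ^ 2 :=
      ⟨_, Real.sqrt_pos.mpr hD, Real.sq_sqrt hD.le⟩
    obtain ⟨x1, hx1⟩ : ∃ x, 2 * K * x = KC + K - 1 - D :=
      ⟨(KC + K - 1 - D) / (2 * K), by field_simp⟩
    obtain ⟨x2, hx2⟩ : ∃ x, 2 * K * x = KC + K - 1 + D :=
      ⟨(KC + K - 1 + D) / (2 * K), by field_simp⟩
    have hs : K * (x1 + x2) = KC + K - 1 := by linear_combination (hx1 + hx2) / 2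
    have hd : K * (x2 - x1) = D := by linear_combination (hx2 - hx1) / 2
    refine ⟨x1, x2, ?_, ?_, ?_⟩
    · rintro rfl
      linarith
    · apply mul_left_cancel₀ (mul_ne_zero hK hKS)
      linear_combination K * hG x1 + K * hG x2
        + ((K * (x1 + x2) + (KC + K - 1)) / 2 + (1 - K)) * hs
        + (K * (x2 - x1) + D) / 2 * hd + hDsq / 2
    · apply mul_left_cancel₀ hKC0.ne'
      linear_combination hG x1 - hG x2 - (x2 - x1) * hs
  · rw [gt_iff_lt, sq_lt_sq, abs_of_pos hKC0, lt_abs]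
    constructor <;> rintro (_ | _)
    · left; linarith
    · right; linarith
    · left; linarith
    · right; linarith
end

section
/- Let G : ℝ → ℝ be any function and define the three-dimensional universal map F : ℝ³ → ℝ³ by F(x, y, z) = (x + y' − z'/2, y', z') where z' = z − G(x) and y' = y + z'. If a point P ∈ ℝ³ satisfies F(F(P)) = P, then F(P) = P; that is, the only period-2 points of the 3D universal map are its fixed points (the points with y = z = 0 and G(x) = 0). -/
/-- For the three-dimensional universal map
`F(x, y, z) = (x + y' − z'/2, y', z')`, `z' = z − G(x)`, `y' = y + z'`,
every period-2 point is a fixed point: `F(F(P)) = P` implies `F(P) = P`; moreover the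
fixed points are exactly the points with `y = z = 0` and `G(x) = 0`. -/
theorem universal_3D_map_period_two_points_are_fixed
    (G : ℝ → ℝ)
    (F : ℝ × ℝ × ℝ → ℝ × ℝ × ℝ)
    (hF : ∀ P : ℝ × ℝ × ℝ,
      F P = (P.1 + (P.2.1 + (P.2.2 - G P.1)) - (P.2.2 - G P.1) / 2,
             P.2.1 + (P.2.2 - G P.1),
             P.2.2 - G P.1)) :
    (∀ P : ℝ × ℝ × ℝ, F (F P) = P → F P = P) ∧
    (∀ P : ℝ × ℝ × ℝ, F P = P ↔ (P.2.1 = 0 ∧ P.2.2 = 0 ∧ G P.1 = 0)) := by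
  have fixed_iff : ∀ P : ℝ × ℝ × ℝ, F P = P ↔ (P.2.1 = 0 ∧ P.2.2 = 0 ∧ G P.1 = 0) := by
    rintro ⟨x, y, z⟩
    simp only [hF, Prod.mk.injEq]
    constructor
    · rintro ⟨hx, hy, hz⟩
      refine ⟨?_, ?_, ?_⟩ <;> linarith
    · rintro ⟨hy, hz, hG⟩
      refine ⟨?_, ?_, ?_⟩ <;> linarith
  refine ⟨?_, fixed_iff⟩
  rintro ⟨x, y, z⟩ h
  rw [fixed_iff]
  simp only [hF, Prod.mk.injEq] at h ⊢
  obtain ⟨hx, hy, hz⟩ := h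
  -- The first coordinate does not move, so both kicks are equal; they also sum to zero.
  have hx' : x + (y + (z - G x)) - (z - G x) / 2 = x := by linarith
  rw [hx'] at hx hy hz
  refine ⟨?_, ?_, ?_⟩ <;> linarith
end

section
/- Let K ∈ ℝ with K ≠ 0 and (K+3)(K−5) ≥ 0, and set D = √((K+3)(K−5)), x_± = (K + 3 ± D)/(2K), p_± = ±D/K. Consider the two-dimensional logistic map F(x, p) = (x + p', p') with p' = p + Kx(1−x) − x. Then F(x_+, p_+) = (x_−, p_−) and F(x_−, p_−) = (x_+, p_+); that is, {(x_+, D/K), (x_−, −D/K)} is a period-2 orbit of the two-dimensional logistic map. -/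
/-- The period `T = 2` orbit of the two-dimensional logistic map
`F(x,p) = (x + p', p')`, `p' = p + Kx(1−x) − x`: for `(K+3)(K−5) ≥ 0`, with
`D = √((K+3)(K−5))`, `x_± = (K+3 ± D)/(2K)`, `p_± = ±D/K`, the map `F` sends
`(x_+, p_+)` to `(x_−, p_−)` and `(x_−, p_−)` to `(x_+, p_+)`. -/
theorem period_two_orbit_of_2D_logistic_map
    (K : ℝ) (hK : K ≠ 0) (hKD : (K + 3) * (K - 5) ≥ 0)
    (D : ℝ) (hD : D = Real.sqrt ((K + 3) * (K - 5)))
    (xp xm : ℝ)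
    (hxp : xp = (K + 3 + D) / (2 * K))
    (hxm : xm = (K + 3 - D) / (2 * K))
    (F : ℝ × ℝ → ℝ × ℝ)
    (hF : ∀ q : ℝ × ℝ, F q = (q.1 + (q.2 + K * q.1 * (1 - q.1) - q.1),
      q.2 + K * q.1 * (1 - q.1) - q.1)) :
    F (xp, D / K) = (xm, -D / K) ∧ F (xm, -D / K) = (xp, D / K) := by
  have hsq : D ^ 2 = (K + 3) * (K - 5) := by rw [hD, Real.sq_sqrt hKD]
  subst hxp hxm
  simp only [hF, Prod.mk.injEq]
  refine ⟨⟨?_, ?_⟩, ?_, ?_⟩ <;> field_simp <;> linarith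
end

section
/- Let 0 < α < 1, let G : ℝ → ℝ, and define the fractional difference map x_{n+1} = x₀ − (1/Γ(α)) Σ_{k=0}^{n} [Γ(n−k+α)/Γ(n−k+1)]·G(x_k) for n ≥ 0. If the trajectory is periodic, i.e. there exists an integer l ≥ 1 such that x_{n+l} = x_n for all n ≥ 0, then the trajectory is a fixed point: x_n = x₀ for all n and G(x₀) = 0. -/
open Finset

open Polynomial in
/-- The polynomials `∏_{s<i} (X+α+s) ∏_{i≤s<L} (X+1+s)`, `i ≤ L`, are linearly independent
when `0 < α < 1`; it is enough to test a linear relation at the positive integers. -/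
lemma coeff_eq_zero_of_sum_prod_eq_zero {α : ℝ} (hα1 : α < 1) (L : ℕ) (c : ℕ → ℝ)
    (h : ∀ n : ℕ, ∑ i ∈ range (L + 1), (∏ s ∈ range i, ((n : ℝ) + 1 + α + s)) *
      (∏ s ∈ Ico i L, ((n : ℝ) + 1 + 1 + s)) * c i = 0) :
    ∀ i ≤ L, c i = 0 := by
  set p : ℝ[X] := ∑ i ∈ range (L + 1), (∏ s ∈ range i, (X + C α + C (s : ℝ))) *
      (∏ s ∈ Ico i L, (X + C 1 + C (s : ℝ))) * C (c i) with hp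
  have heval : ∀ t : ℝ, p.eval t = ∑ i ∈ range (L + 1), (∏ s ∈ range i, (t + α + s)) *
      (∏ s ∈ Ico i L, (t + 1 + s)) * c i := by
    intro t
    simp only [hp, eval_finsetSum, eval_mul, eval_prod, eval_add, eval_X, eval_C]
  have hp0 : p = 0 := by
    apply eq_zero_of_infinite_isRoot
    refine (Set.infinite_range_of_injective (f := fun n : ℕ => (n : ℝ) + 1) ?_).mono ?_
    · intro a b hab
      simpa using hab
    · rintro _ ⟨n, rfl⟩
      exact (heval _).trans (h n)
  intro i
  induction i using Nat.strong_induction_on with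
  | _ i ih =>
    intro hi
    have h0 := heval (-α - i)
    rw [hp0, eval_zero, sum_eq_single i] at h0
    · rcases mul_eq_zero.mp h0.symm with h1 | h1
      · exfalso
        rcases mul_eq_zero.mp h1 with h2 | h2
        · obtain ⟨s, hs, hs0⟩ := prod_eq_zero_iff.mp h2
          have : (s : ℝ) < i := by exact_mod_cast mem_range.mp hs
          linarith
        · obtain ⟨s, hs, hs0⟩ := prod_eq_zero_iff.mp h2
          have : (i : ℝ) ≤ s := by exact_mod_cast (mem_Ico.mp hs).1
          linarith
      · exact h1
    · intro j hj hji
      rcases lt_or_gt_of_ne hji with hlt | hgt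
      · rw [ih j hlt (by omega), mul_zero]
      · rw [prod_eq_zero (mem_range.mpr hgt) (by ring), zero_mul, zero_mul]
    · intro hni
      exact absurd (mem_range.mpr (by omega)) hni

/-- Shifted values of the falling factorial kernel `Γ(n+α)/Γ(n+1)` in terms of one value. -/
lemma Gamma_div_Gamma_mul_prod {α : ℝ} (hα0 : 0 < α) (m i : ℕ) :
    Real.Gamma (((m + i : ℕ) : ℝ) + α) / Real.Gamma (((m + i : ℕ) : ℝ) + 1) *
        ∏ s ∈ range i, ((m : ℝ) + 1 + s) =
      Real.Gamma ((m : ℝ) + α) / Real.Gamma ((m : ℝ) + 1) *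
        ∏ s ∈ range i, ((m : ℝ) + α + s) := by
  induction i with
  | zero => simp
  | succ i ih =>
    have h1 : Real.Gamma (((m + (i + 1) : ℕ) : ℝ) + α) =
        ((m : ℝ) + α + i) * Real.Gamma (((m + i : ℕ) : ℝ) + α) := by
      rw [show ((m : ℝ) + α + i) = ((m + i : ℕ) : ℝ) + α by push_cast; ring,
        ← Real.Gamma_add_one (by positivity)]
      congr 1
      push_cast
      ring
    have h2 : Real.Gamma (((m + (i + 1) : ℕ) : ℝ) + 1) =
        ((m : ℝ) + 1 + i) * Real.Gamma (((m + i : ℕ) : ℝ) + 1) := by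
      rw [show ((m : ℝ) + 1 + i) = ((m + i : ℕ) : ℝ) + 1 by push_cast; ring,
        ← Real.Gamma_add_one (by positivity)]
      congr 1
      push_cast
      ring
    have h3 : Real.Gamma (((m + i : ℕ) : ℝ) + 1) ≠ 0 :=
      (Real.Gamma_pos_of_pos (by positivity)).ne'
    have h4 : (m : ℝ) + 1 + i ≠ 0 := by positivity
    rw [prod_range_succ, prod_range_succ, h1, h2, ← mul_assoc, ← mul_assoc, ← ih]
    field_simp

/-- If the convolution of a periodic sequence with a kernel is periodic with the same period,
then the kernel satisfies a linear recurrence. -/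
lemma sum_kernel_eq_zero_of_periodic (w g : ℕ → ℝ) (L : ℕ)
    (hg : ∀ n, g (n + (L + 1)) = g n)
    (hS : ∀ n, ∑ k ∈ range (n + (L + 1) + 1), w (n + (L + 1) - k) * g k =
      ∑ k ∈ range (n + 1), w (n - k) * g k) (n : ℕ) :
    ∑ i ∈ range (L + 1), w (n + 1 + i) * g (L - i) = 0 := by
  have h := hS n
  rw [show n + (L + 1) + 1 = (L + 1) + (n + 1) by ring, sum_range_add] at h
  have h2 : ∑ k ∈ range (n + 1), w (n + (L + 1) - (L + 1 + k)) * g (L + 1 + k) =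
      ∑ k ∈ range (n + 1), w (n - k) * g k := by
    refine sum_congr rfl fun k _ => ?_
    rw [add_comm (L + 1) k, hg, Nat.add_sub_add_right]
  rw [h2, add_eq_right, ← sum_range_reflect] at h
  rw [← h]
  refine sum_congr rfl fun i hi => ?_
  have := mem_range.mp hi
  congr 2
  omega

/-- Fractional difference maps have no periodic points except fixed points: if a trajectory
of the Caputo fractional difference universal map of order `0 < α < 1`,
`x_{n+1} = x₀ − (1/Γ(α)) Σ_{k=0}^{n} [Γ(n−k+α)/Γ(n−k+1)] G(x_k)`,
is periodic with some period `l ≥ 1`, then it is a fixed point: `x_n = x₀` for all `n`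
and `G(x₀) = 0`. -/
theorem fractional_difference_map_periodic_implies_fixed
    (α : ℝ) (hα0 : 0 < α) (hα1 : α < 1)
    (G : ℝ → ℝ) (x : ℕ → ℝ)
    (hx : ∀ n : ℕ, x (n + 1) = x 0 - (1 / Real.Gamma α) *
      ∑ k ∈ range (n + 1),
        (Real.Gamma ((n : ℝ) - k + α) / Real.Gamma ((n : ℝ) - k + 1)) * G (x k))
    (l : ℕ) (hl : 1 ≤ l) (hper : ∀ n : ℕ, x (n + l) = x n) :
    (∀ n : ℕ, x n = x 0) ∧ G (x 0) = 0 := by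
  obtain ⟨L, rfl⟩ : ∃ L, l = L + 1 := ⟨l - 1, by omega⟩
  set w : ℕ → ℝ := fun n => Real.Gamma ((n : ℝ) + α) / Real.Gamma ((n : ℝ) + 1) with hw
  have hΓ : 1 / Real.Gamma α ≠ 0 := one_div_ne_zero (Real.Gamma_pos_of_pos hα0).ne'
  have hx' : ∀ n : ℕ, x (n + 1) = x 0 - (1 / Real.Gamma α) *
      ∑ k ∈ range (n + 1), w (n - k) * G (x k) := by
    intro n
    rw [hx n]
    congr 2
    refine sum_congr rfl fun k hk => ?_
    simp only [hw, Nat.cast_sub (Nat.lt_succ_iff.mp (mem_range.mp hk))]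
  have hrec := sum_kernel_eq_zero_of_periodic w (fun n => G (x n)) L
    (fun n => congrArg G (hper n)) fun n => by
      have h := hper (n + 1)
      rw [show n + 1 + (L + 1) = n + (L + 1) + 1 by ring, hx', hx' n, sub_right_inj] at h
      exact mul_left_cancel₀ hΓ h
  have hzero := coeff_eq_zero_of_sum_prod_eq_zero hα1 L (fun i => G (x (L - i))) fun n => by
    have hwpos : w (n + 1) ≠ 0 :=
      (div_pos (Real.Gamma_pos_of_pos (by positivity))
        (Real.Gamma_pos_of_pos (by positivity))).ne'
    refine (mul_eq_zero.mp ?_).resolve_left hwpos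
    rw [← zero_mul (∏ s ∈ range L, ((n : ℝ) + 1 + 1 + s)), ← hrec n, mul_sum, sum_mul]
    refine sum_congr rfl fun i hi => ?_
    have hshift := Gamma_div_Gamma_mul_prod hα0 (n + 1) i
    rw [← prod_range_mul_prod_Ico _ (Nat.lt_succ_iff.mp (mem_range.mp hi))]
    push_cast at hshift
    simp only [hw]
    push_cast
    linear_combination (-(∏ s ∈ Ico i L, ((n : ℝ) + 1 + 1 + s)) * G (x (L - i))) * hshift
  have hlow : ∀ k < L + 1, G (x k) = 0 := by
    intro k hk
    have h := hzero (L - k) (by omega)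
    rwa [Nat.sub_sub_self (by omega)] at h
  have hG : ∀ k, G (x k) = 0 := by
    intro k
    rw [← Function.Periodic.map_mod_nat (f := x) hper k]
    exact hlow _ (Nat.mod_lt _ (by omega))
  refine ⟨fun n => ?_, hG 0⟩
  cases n with
  | zero => rfl
  | succ n => simp [hx' n, hG]
end
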